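/- (Gårding's inequality for M-elliptic operators) Let m ∈ ℝ and let σ ∈ M^{2m}_{ρ,Λ} be strongly M-elliptic: there exist C > 0 and R > 0 with Re σ(x,ξ) ≥ C Λ(ξ)^{2m} for all x ∈ ℝⁿ and all |ξ| ≥ R. Then there exists a constant C' > 0 and, for every real number s ≥ ρ/2, a constant C_s > 0 such that for all φ ∈ 𝒮(ℝⁿ), Re ∫_{ℝⁿ} (T_σφ)(x) \overline{φ(x)} dx ≥ C' ‖φ‖²_{m,2,Λ} − C_s ‖φ‖²_{m−s,2,Λ}. -/

import Mathlib

open MeasureTheory Real Filter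
open scoped RealInnerProductSpace BigOperators ENNReal

noncomputable section

/-- Euclidean space ℝⁿ. -/
abbrev En (n : ℕ) : Type := EuclideanSpace ℝ (Fin n)

/-- Partial derivative in the `i`-th coordinate direction. -/
def pd {n : ℕ} {F : Type*} [NormedAddCommGroup F] [NormedSpace ℝ F]
    (i : Fin n) (f : En n → F) : En n → F :=
  fun x => fderiv ℝ f x (EuclideanSpace.single i 1)

/-- Iterated partial derivative `∂^α` for a multi-index `α`. -/
def mpd {n : ℕ} {F : Type*} [NormedAddCommGroup F] [NormedSpace ℝ F]
    (α : Fin n → ℕ) (f : En n → F) : En n → F :=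
  (List.finRange n).foldr (fun i g => (pd i)^[α i] g) f

/-- Mixed derivative `∂_x^α ∂_ξ^β σ` of a symbol. -/
def mixpd {n : ℕ} (α β : Fin n → ℕ) (σ : En n → En n → ℂ) : En n → En n → ℂ :=
  fun x ξ => mpd α (fun y => mpd β (σ y) ξ) x

/-- `Λ` is a weight function of polynomial growth with parameters `μ₀ ≤ μ₁ ≤ μ`. -/
structure IsWeight (n : ℕ) (Λ : En n → ℝ) (μ₀ μ₁ μ : ℝ) : Prop where
  pos : ∀ ξ, 0 < Λ ξ
  smooth : ContDiff ℝ (⊤ : ℕ∞) Λ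
  growth : ∃ C₀ C₁ : ℝ, 0 < C₀ ∧ C₀ ≤ C₁ ∧ ∀ ξ : En n,
    C₀ * (1 + ‖ξ‖) ^ μ₀ ≤ Λ ξ ∧ Λ ξ ≤ C₁ * (1 + ‖ξ‖) ^ μ₁
  hμ₀ : 0 < μ₀
  hμ₀₁ : μ₀ ≤ μ₁
  hμ₁ : μ₁ ≤ μ
  deriv_bound : ∀ (α γ : Fin n → ℕ), (∀ i, γ i ≤ 1) →
    ∃ C > 0, ∀ ξ : En n,
      |(∏ i, ξ i ^ γ i) * mpd (α + γ) Λ ξ| ≤ C * Λ ξ ^ (1 - (∑ i, (α i : ℝ)) / μ)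

/-- The symbol class `S^m_{ρ,Λ}`. -/
def SClass {n : ℕ} (Λ : En n → ℝ) (ρ m : ℝ) (σ : En n → En n → ℂ) : Prop :=
  ContDiff ℝ (⊤ : ℕ∞) (fun q : En n × En n => σ q.1 q.2) ∧
  ∀ α β : Fin n → ℕ, ∃ C > 0, ∀ x ξ : En n,
    ‖mixpd α β σ x ξ‖ ≤ C * Λ ξ ^ (m - ρ * ∑ i, (β i : ℝ))

/-- The symbol class `M^m_{ρ,Λ}`. -/
def MClass {n : ℕ} (Λ : En n → ℝ) (ρ m : ℝ) (σ : En n → En n → ℂ) : Prop :=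
  ∀ γ : Fin n → ℕ, (∀ i, γ i ≤ 1) →
    SClass Λ ρ m (fun x ξ => ((∏ i, ξ i ^ γ i : ℝ) : ℂ) * mixpd 0 γ σ x ξ)

/-- The Fourier transform `φ̂(ξ) = (2π)^{-n/2} ∫ e^{-ix·ξ} φ(x) dx`. -/
def ft {n : ℕ} (φ : En n → ℂ) (ξ : En n) : ℂ :=
  (((2 * Real.pi) ^ (-(n : ℝ) / 2) : ℝ) : ℂ) *
    ∫ (x : En n), Complex.exp (-Complex.I * (⟪x, ξ⟫ : ℂ)) * φ x

/-- The pseudo-differential operator `T_σ`. -/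
def pdo {n : ℕ} (σ : En n → En n → ℂ) (φ : En n → ℂ) (x : En n) : ℂ :=
  (((2 * Real.pi) ^ (-(n : ℝ) / 2) : ℝ) : ℂ) *
    ∫ (ξ : En n), Complex.exp (Complex.I * (⟪x, ξ⟫ : ℂ)) * σ x ξ * ft φ ξ

end

noncomputable section

/-- The SG symbol class `S^{m₁,m₂}_{ρ,Λ}`. -/
def SGClass {n : ℕ} (Λ : En n → ℝ) (ρ m₁ m₂ : ℝ) (σ : En n → En n → ℂ) : Prop :=
  ContDiff ℝ (⊤ : ℕ∞) (fun q : En n × En n => σ q.1 q.2) ∧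
  ∀ α β : Fin n → ℕ, ∃ C > 0, ∀ x ξ : En n,
    ‖mixpd α β σ x ξ‖ ≤
      C * Λ x ^ (m₂ - ρ * ∑ i, (α i : ℝ)) * Λ ξ ^ (m₁ - ρ * ∑ i, (β i : ℝ))

/-- The SG symbol class `M^{m₁,m₂}_{ρ,Λ}`. -/
def SGMClass {n : ℕ} (Λ : En n → ℝ) (ρ m₁ m₂ : ℝ) (σ : En n → En n → ℂ) : Prop :=
  ∀ γ δ : Fin n → ℕ, (∀ i, γ i ≤ 1) → (∀ i, δ i ≤ 1) →
    SGClass Λ ρ m₁ m₂ (fun x ξ =>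
      ((∏ i, x i ^ δ i : ℝ) : ℂ) * ((∏ i, ξ i ^ γ i : ℝ) : ℂ) * mixpd δ γ σ x ξ)

end

noncomputable section

open scoped FourierTransform ContDiff ComplexConjugate SchwartzMap

/-- The unit complex number `e^{it}`. -/
def cis (t : ℝ) : ℂ := Complex.exp (Complex.I * t)

lemma cis_add (s t : ℝ) : cis (s + t) = cis s * cis t := by
  simp [cis, mul_add, Complex.exp_add]

@[simp] lemma cis_zero : cis 0 = 1 := by simp [cis]

@[simp] lemma norm_cis (t : ℝ) : ‖cis t‖ = 1 := by
  rw [cis, mul_comm, Complex.norm_exp_ofReal_mul_I]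

lemma conj_cis (t : ℝ) : conj (cis t) = cis (-t) := by
  simp [cis, ← Complex.exp_conj]

@[fun_prop] lemma continuous_cis : Continuous cis := by
  unfold cis; fun_prop

variable {n : ℕ}

/-- The unnormalised oscillatory integral `∫ e^{i y·ξ} f(y) dy`. -/
def osc (f : En n → ℂ) (ξ : En n) : ℂ := ∫ y, cis ⟪y, ξ⟫ * f y

lemma two_pi_inv_ne_zero : (2 * π)⁻¹ ≠ 0 := by positivity

lemma osc_eq_fourierInv (f : En n → ℂ) (ξ : En n) : osc f ξ = 𝓕⁻ f ((2 * π)⁻¹ • ξ) := by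
  rw [Real.fourierInv_eq']
  unfold osc cis
  congr 1 with y
  rw [inner_smul_right, smul_eq_mul, ← mul_assoc, mul_inv_cancel₀ (by positivity), one_mul,
    mul_comm Complex.I]

/-- Scaling by a nonzero real as a continuous linear equivalence. -/
def scaleCLE (a : ℝ) (ha : a ≠ 0) : En n ≃L[ℝ] En n :=
  ContinuousLinearEquiv.smulLeft (Units.mk0 a ha)

/-- The Schwartz function underlying `osc f`. -/
def oscS (f : 𝓢(En n, ℂ)) : 𝓢(En n, ℂ) :=
  SchwartzMap.compCLMOfContinuousLinearEquiv ℂ (scaleCLE (2 * π)⁻¹ two_pi_inv_ne_zero) (𝓕⁻ f)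

lemma oscS_apply (f : 𝓢(En n, ℂ)) (ξ : En n) : oscS f ξ = osc f ξ := by
  rw [osc_eq_fourierInv, ← SchwartzMap.fourierInv_coe]
  rfl

lemma finrank_En : Module.finrank ℝ (En n) = n := by simp

lemma integral_comp_inv_two_pi {G : Type*} [NormedAddCommGroup G] [NormedSpace ℝ G]
    (F : En n → G) : ∫ ξ, F ((2 * π)⁻¹ • ξ) = (2 * π) ^ n • ∫ ξ, F ξ := by
  rw [Measure.integral_comp_smul, finrank_En]
  congr 1
  rw [abs_of_pos (by positivity), inv_pow, inv_inv]

lemma integral_norm_sq_osc (f : 𝓢(En n, ℂ)) :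
    ∫ ξ, ‖osc f ξ‖ ^ 2 = (2 * π) ^ n * ∫ y, ‖f y‖ ^ 2 := by
  simp_rw [osc_eq_fourierInv]
  rw [integral_comp_inv_two_pi (fun ξ => ‖𝓕⁻ (f : En n → ℂ) ξ‖ ^ 2), smul_eq_mul]
  congr 1
  rw [← SchwartzMap.fourierInv_coe, ← SchwartzMap.integral_norm_sq_fourier (𝓕⁻ f)]
  simp

lemma osc_oscS_neg (f : 𝓢(En n, ℂ)) (x : En n) :
    osc (oscS f) (-x) = (2 * π) ^ n * f x := by
  have h1 : osc (oscS f) (-x)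
      = ∫ ξ, (fun ζ => cis (-(2 * π * ⟪ζ, x⟫)) * (𝓕⁻ f : 𝓢(En n, ℂ)) ζ) ((2 * π)⁻¹ • ξ) := by
    unfold osc
    congr 1 with ξ
    simp only [inner_neg_right, real_inner_smul_left, oscS_apply, osc_eq_fourierInv,
      SchwartzMap.fourierInv_coe]
    rw [mul_inv_cancel_left₀ (by positivity)]
  rw [h1, integral_comp_inv_two_pi (fun ζ => cis (-(2 * π * ⟪ζ, x⟫)) * (𝓕⁻ f : 𝓢(En n, ℂ)) ζ)]
  have h2 : f x = 𝓕 (𝓕⁻ f) x := by simp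
  rw [h2, SchwartzMap.fourier_coe, Real.fourier_eq', Complex.real_smul]
  push_cast
  congr 2 with ζ
  simp only [cis, smul_eq_mul]
  congr 2
  push_cast
  ring

/-- The normalising constant `(2π)^{-n/2}`. -/
def cn (n : ℕ) : ℝ := (2 * Real.pi) ^ (-(n : ℝ) / 2)

lemma cn_pos : 0 < cn n := by unfold cn; positivity

lemma cn_sq : (2 * π) ^ n * (cn n * cn n) = 1 := by
  unfold cn
  rw [← Real.rpow_add (by positivity), ← Real.rpow_natCast, ← Real.rpow_add (by positivity)]
  ring_nf
  simp

lemma ft_eq (f : En n → ℂ) (ξ : En n) : ft f ξ = cn n * osc f (-ξ) := by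
  unfold ft osc cn cis
  congr 2 with y
  simp

/-- The Fourier transform as a Schwartz function. -/
def ftS (f : 𝓢(En n, ℂ)) : 𝓢(En n, ℂ) :=
  (cn n : ℂ) • SchwartzMap.compCLMOfContinuousLinearEquiv ℂ
    (scaleCLE (-1) (by norm_num)) (oscS f)

lemma ftS_apply (f : 𝓢(En n, ℂ)) (ξ : En n) : ftS f ξ = ft f ξ := by
  rw [ft_eq, ← oscS_apply]
  have : ftS f ξ = cn n * oscS f ((-1 : ℝ) • ξ) := rfl
  rw [this]; simp

lemma inversion (f : 𝓢(En n, ℂ)) (x : En n) : f x = cn n * osc (ftS f) x := by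
  have h1 : osc (ftS f) x = cn n * osc (oscS f) (-x) := by
    unfold osc
    rw [← integral_neg_eq_self, ← integral_const_mul]
    congr 1 with ξ
    rw [ftS_apply, ft_eq, ← oscS_apply]
    simp
    ring
  rw [h1, osc_oscS_neg]
  have := cn_sq (n := n)
  have h3 : ((2 * π) ^ n * ((cn n : ℂ) * cn n)) = 1 := by exact_mod_cast this
  linear_combination (-f x) * h3

end

noncomputable section

open scoped FourierTransform ContDiff ComplexConjugate SchwartzMap

variable {n : ℕ}

lemma SchwartzMap.integrable_norm_sq (f : 𝓢(En n, ℂ)) : Integrable (fun x => ‖f x‖ ^ 2) :=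
  (memLp_two_iff_integrable_sq_norm f.continuous.aestronglyMeasurable).1 (f.memLp 2)

lemma lintegral_enorm_sq (f : 𝓢(En n, ℂ)) :
    ∫⁻ x, ‖f x‖ₑ ^ 2 = ENNReal.ofReal (∫ x, ‖f x‖ ^ 2) := by
  rw [ofReal_integral_eq_lintegral_ofReal f.integrable_norm_sq
    (Eventually.of_forall fun _ => by positivity)]
  congr 1 with x
  rw [ENNReal.ofReal_pow (norm_nonneg _), ofReal_norm]

lemma lintegral_enorm_sq_osc (f : 𝓢(En n, ℂ)) :
    ∫⁻ ξ, ‖osc f ξ‖ₑ ^ 2 = ENNReal.ofReal ((2 * π) ^ n) * ∫⁻ y, ‖f y‖ₑ ^ 2 := by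
  simp_rw [← oscS_apply]
  rw [lintegral_enorm_sq, lintegral_enorm_sq, ← ENNReal.ofReal_mul (by positivity),
    ← integral_norm_sq_osc]
  simp_rw [oscS_apply]

/-- Short-time transform in the frequency variable, with window `osc g` at scale `κ`. -/
def Vk (g v : 𝓢(En n, ℂ)) (κ : ℝ) (x ξ : En n) : ℂ :=
  ∫ t, oscS g t * cis (κ * ⟪x, t⟫) * v (ξ + κ • t)

/-- Short-time transform in the space variable, with window `g` at scale `κ⁻¹`. -/
def Uk (g u : 𝓢(En n, ℂ)) (κ : ℝ) (x ξ : En n) : ℂ :=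
  ∫ y, g y * cis (-(κ⁻¹ * ⟪y, ξ⟫)) * u (x + κ⁻¹ • y)

/-- The product `oscS g t * v (ξ + κ t)` as a Schwartz function. -/
def windowed (g v : 𝓢(En n, ℂ)) (κ : ℝ) (ξ : En n) : 𝓢(En n, ℂ) :=
  SchwartzMap.smulLeftCLM ℂ (fun t => v (ξ + κ • t)) (oscS g)

lemma windowed_apply (g v : 𝓢(En n, ℂ)) (κ : ℝ) (ξ t : En n) :
    windowed g v κ ξ t = oscS g t * v (ξ + κ • t) := by
  unfold windowed
  rw [SchwartzMap.smulLeftCLM_apply_apply, smul_eq_mul, mul_comm]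
  have h1 : Function.HasTemperateGrowth (fun t : En n => ξ + κ • t) :=
    (Function.HasTemperateGrowth.const ξ).add
      ((κ • ContinuousLinearMap.id ℝ (En n)).hasTemperateGrowth)
  exact (v.hasTemperateGrowth).comp h1

lemma Vk_eq_osc (g v : 𝓢(En n, ℂ)) (κ : ℝ) (x ξ : En n) :
    Vk g v κ x ξ = osc (windowed g v κ ξ) (κ • x) := by
  unfold Vk osc
  congr 1 with t
  rw [windowed_apply, real_inner_smul_right, real_inner_comm]
  ring

lemma SchwartzMap.exists_bound (f : 𝓢(En n, ℂ)) : ∃ C, 0 ≤ C ∧ ∀ x, ‖f x‖ ≤ C := by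
  obtain ⟨C, hC⟩ := f.decay 0 0
  exact ⟨C, hC.1.le, fun x => by simpa using hC.2 x⟩

lemma continuous_Vk (g v : 𝓢(En n, ℂ)) (κ : ℝ) :
    Continuous (fun q : En n × En n => Vk g v κ q.1 q.2) := by
  obtain ⟨C, hC0, hC⟩ := v.exists_bound
  refine continuous_of_dominated (bound := fun t => ‖oscS g t‖ * C) ?_ ?_ ?_ ?_
  · intro q
    have := (oscS g).continuous
    have := v.continuous
    exact Continuous.aestronglyMeasurable (by fun_prop)
  · intro q
    refine Eventually.of_forall fun t => ?_
    rw [norm_mul, norm_mul, norm_cis, mul_one]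
    gcongr
    exact hC _
  · exact (oscS g).integrable.norm.mul_const C
  · refine Eventually.of_forall fun t => ?_
    have := v.continuous
    fun_prop

lemma lintegral_comp_smul_En {κ : ℝ} (hκ : 0 < κ) (F : En n → ℝ≥0∞) (hF : Measurable F) :
    ∫⁻ x, F (κ • x) = ENNReal.ofReal (κ⁻¹ ^ n) * ∫⁻ x, F x := by
  rw [← lintegral_map (f := F) hF (measurable_const_smul κ), Measure.map_addHaar_smul _ hκ.ne',
    lintegral_smul_measure, finrank_En, smul_eq_mul]
  congr 2
  rw [abs_of_pos (by positivity), inv_pow]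

lemma lintegral_Vk (g v : 𝓢(En n, ℂ)) {κ : ℝ} (hκ : 0 < κ) (ξ : En n) :
    ∫⁻ x, ‖Vk g v κ x ξ‖ₑ ^ 2 = ENNReal.ofReal ((2 * π / κ) ^ n) *
      ∫⁻ t, ‖oscS g t‖ₑ ^ 2 * ‖v (ξ + κ • t)‖ₑ ^ 2 := by
  simp_rw [Vk_eq_osc, ← oscS_apply]
  rw [lintegral_comp_smul_En hκ (fun x => ‖oscS (windowed g v κ ξ) x‖ₑ ^ 2)
    (by have := (oscS (windowed g v κ ξ)).continuous; fun_prop)]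
  simp_rw [oscS_apply]
  rw [lintegral_enorm_sq_osc, ← mul_assoc, ← ENNReal.ofReal_mul (by positivity), ← mul_pow]
  congr 2
  · congr 1; field_simp
  · ext t
    rw [windowed_apply, enorm_mul, mul_pow, oscS_apply]

lemma lintegral_weight_Vk (g v : 𝓢(En n, ℂ)) {κ : ℝ} (hκ : 0 < κ) (w : En n → ℝ≥0∞)
    (hw : Measurable w) :
    ∫⁻ ξ, w ξ * ∫⁻ x, ‖Vk g v κ x ξ‖ₑ ^ 2 = ENNReal.ofReal ((2 * π / κ) ^ n) *
      ∫⁻ ζ, ‖v ζ‖ₑ ^ 2 * ∫⁻ t, ‖oscS g t‖ₑ ^ 2 * w (ζ - κ • t) := by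
  have h1 := (oscS g).continuous
  have h2 := v.continuous
  have m1 : Measurable fun t => ‖oscS g t‖ₑ ^ 2 := by fun_prop
  have m2 : Measurable fun t => ‖v t‖ₑ ^ 2 := by fun_prop
  simp_rw [lintegral_Vk g v hκ, mul_left_comm (w _)]
  rw [lintegral_const_mul' _ _ ENNReal.ofReal_ne_top]
  congr 1
  calc ∫⁻ ξ, w ξ * ∫⁻ t, ‖oscS g t‖ₑ ^ 2 * ‖v (ξ + κ • t)‖ₑ ^ 2
      = ∫⁻ ξ, ∫⁻ t, w ξ * (‖oscS g t‖ₑ ^ 2 * ‖v (ξ + κ • t)‖ₑ ^ 2) := by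
        congr 1 with ξ
        rw [lintegral_const_mul]
        exact m1.mul (m2.comp (by fun_prop))
    _ = ∫⁻ t, ∫⁻ ξ, w ξ * (‖oscS g t‖ₑ ^ 2 * ‖v (ξ + κ • t)‖ₑ ^ 2) := by
        rw [lintegral_lintegral_swap]
        refine Measurable.aemeasurable ?_
        have h3 : Measurable fun q : En n × En n => ‖v (q.1 + κ • q.2)‖ₑ ^ 2 :=
          m2.comp (g := fun ζ => ‖v ζ‖ₑ ^ 2)
            (by fun_prop : Measurable fun q : En n × En n => q.1 + κ • q.2)
        exact (hw.comp measurable_fst).mul ((m1.comp measurable_snd).mul h3)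
    _ = ∫⁻ t, ∫⁻ ζ, w (ζ - κ • t) * (‖oscS g t‖ₑ ^ 2 * ‖v ζ‖ₑ ^ 2) := by
        congr 1 with t
        rw [← lintegral_sub_right_eq_self _ (κ • t)]
        simp
    _ = ∫⁻ ζ, ∫⁻ t, w (ζ - κ • t) * (‖oscS g t‖ₑ ^ 2 * ‖v ζ‖ₑ ^ 2) := by
        rw [lintegral_lintegral_swap]
        refine Measurable.aemeasurable ?_
        have h3 : Measurable fun q : En n × En n => w (q.2 - κ • q.1) := by
          exact hw.comp (by fun_prop)
        exact h3.mul ((m1.comp measurable_fst).mul (m2.comp measurable_snd))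
    _ = _ := by
        congr 1 with ζ
        rw [← lintegral_const_mul]
        · congr 1 with t; ring
        · exact m1.mul (hw.comp (by fun_prop))

/-- The two short-time transforms agree up to phase and normalisation. -/
lemma Uk_eq (g u : 𝓢(En n, ℂ)) {κ : ℝ} (hκ : 0 < κ) (x ξ : En n) :
    Uk g u κ x ξ = (cn n * κ ^ n : ℝ) * (cis ⟪x, ξ⟫ * Vk g (ftS u) κ x ξ) := by
  set v := ftS u
  have hv := v.continuous
  have hg := g.continuous
  calc Uk g u κ x ξ
      = ∫ y, ∫ ζ, (cn n : ℂ) * (g y * cis (-(κ⁻¹ * ⟪y, ξ⟫)) * (cis ⟪ζ, x + κ⁻¹ • y⟫ * v ζ)) := by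
        unfold Uk
        congr 1 with y
        rw [inversion u, integral_const_mul, integral_const_mul]
        unfold osc
        ring
    _ = ∫ ζ, ∫ y, (cn n : ℂ) * (g y * cis (-(κ⁻¹ * ⟪y, ξ⟫)) * (cis ⟪ζ, x + κ⁻¹ • y⟫ * v ζ)) := by
        rw [integral_integral_swap]
        refine Integrable.const_mul ?_ _
        have := (g.integrable (μ := volume)).mul_prod (v.integrable (μ := volume))
        refine this.mono (Continuous.aestronglyMeasurable (by fun_prop))
          (Eventually.of_forall fun q => ?_)
        simp
    _ = ∫ ζ, (fun t => (cn n : ℂ) * (cis ⟪ξ + κ • t, x⟫ * v (ξ + κ • t) * oscS g t))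
          (κ⁻¹ • (ζ - ξ)) := by
        congr 1 with ζ
        have : ξ + κ • κ⁻¹ • (ζ - ξ) = ζ := by
          rw [smul_smul, mul_inv_cancel₀ hκ.ne', one_smul]; abel
        simp only [this]
        rw [oscS_apply, osc, ← integral_const_mul, ← integral_const_mul]
        congr 1 with y
        have e1 : cis ⟪y, κ⁻¹ • (ζ - ξ)⟫ = cis (κ⁻¹ * ⟪ζ, y⟫) * cis (-(κ⁻¹ * ⟪y, ξ⟫)) := by
          rw [← cis_add, real_inner_smul_right, inner_sub_right, real_inner_comm y ζ]
          congr 1; ring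
        rw [e1, inner_add_right, real_inner_smul_right, cis_add]
        ring
    _ = _ := by
        rw [integral_sub_right_eq_self (fun ζ => (fun t => (cn n : ℂ) * (cis ⟪ξ + κ • t, x⟫ *
          v (ξ + κ • t) * oscS g t)) (κ⁻¹ • ζ)) ξ, Measure.integral_comp_smul volume (fun t => (cn n : ℂ) *
          (cis ⟪ξ + κ • t, x⟫ * v (ξ + κ • t) * oscS g t)), finrank_En,
          integral_const_mul, Vk, Complex.real_smul, abs_of_pos (by positivity), inv_pow,
          inv_inv]
        have : ∀ t, cis ⟪ξ + κ • t, x⟫ * v (ξ + κ • t) * oscS g t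
            = cis ⟪x, ξ⟫ * (oscS g t * cis (κ * ⟪x, t⟫) * v (ξ + κ • t)) := by
          intro t
          rw [inner_add_left, real_inner_smul_left, cis_add, real_inner_comm x ξ,
            real_inner_comm x t]
          ring
        simp_rw [this]
        rw [integral_const_mul]
        push_cast
        ring

/-- The Rihaczek kernel `e^{i x·ξ} v(ξ) conj(u(x))`. -/
def Rk (u v : 𝓢(En n, ℂ)) (X : En n × En n) : ℂ := cis ⟪X.1, X.2⟫ * v X.2 * conj (u X.1)

/-- The Rihaczek kernel of the window. -/
def winR (g : 𝓢(En n, ℂ)) (Y : En n × En n) : ℂ := cis (-⟪Y.1, Y.2⟫) * g Y.1 * oscS g Y.2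

lemma integral_winR_mul_Rk (g u v : 𝓢(En n, ℂ)) (hg : ∀ y, conj (g y) = g y) {κ : ℝ} (hκ : 0 < κ)
    (x ξ p q : En n) :
    ∫ Y : En n × En n, cis (⟪p, Y.1⟫ + ⟪q, Y.2⟫) *
        (winR g Y * Rk u v (x + κ⁻¹ • Y.1, ξ + κ • Y.2))
      = cis ⟪x, ξ⟫ * conj (Uk g u κ x (ξ + κ • p)) * Vk g v κ (x + κ⁻¹ • q) ξ := by
  rw [Uk, Vk, ← integral_conj, mul_assoc, ← integral_prod_mul, ← integral_const_mul,
    Measure.volume_eq_prod]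
  congr 1 with Y
  simp only [winR, Rk, map_mul, hg, conj_cis, neg_neg]
  have e : cis (⟪p, Y.1⟫ + ⟪q, Y.2⟫) * (cis (-⟪Y.1, Y.2⟫)
      * cis ⟪x + κ⁻¹ • Y.1, ξ + κ • Y.2⟫) = cis ⟪x, ξ⟫ *
      (cis (κ⁻¹ * ⟪Y.1, ξ + κ • p⟫) * cis (κ * ⟪x + κ⁻¹ • q, Y.2⟫)) := by
    simp only [← cis_add]
    congr 1
    simp only [inner_add_left, inner_add_right, real_inner_smul_left, real_inner_smul_right,
      real_inner_comm p Y.1]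
    field_simp
    ring
  linear_combination (g Y.1 * oscS g Y.2 * v (ξ + κ • Y.2) * conj (u (x + κ⁻¹ • Y.1))) * e

end

noncomputable section

open scoped FourierTransform ContDiff ComplexConjugate SchwartzMap

section DirectionalDerivative

variable {G : Type*} [NormedAddCommGroup G] [NormedSpace ℝ G]
  {H : Type*} [NormedAddCommGroup H] [NormedSpace ℝ H]

/-- The derivative in the direction `e`. -/
def dirD (e : G) (f : G → ℂ) : G → ℂ := fun X => fderiv ℝ f X e

lemma ContDiff.dirD {f : G → ℂ} (hf : ContDiff ℝ ∞ f) (e : G) : ContDiff ℝ ∞ (dirD e f) :=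
  (hf.fderiv_right (m := ∞) (by simp)).clm_apply contDiff_const

lemma dirD_add {f g : G → ℂ} (hf : ContDiff ℝ ∞ f) (hg : ContDiff ℝ ∞ g) (e : G) :
    dirD e (f + g) = dirD e f + dirD e g := by
  ext X
  simp only [dirD, Pi.add_apply]
  rw [fderiv_add (hf.differentiable (by simp)).differentiableAt
    (hg.differentiable (by simp)).differentiableAt]
  rfl

lemma dirD_iterate_add {f g : G → ℂ} (hf : ContDiff ℝ ∞ f) (hg : ContDiff ℝ ∞ g) (e : G)
    (k : ℕ) : (dirD e)^[k] (f + g) = (dirD e)^[k] f + (dirD e)^[k] g := by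
  induction k generalizing f g with
  | zero => rfl
  | succ k ih =>
    simp only [Function.iterate_succ_apply]
    rw [dirD_add hf hg, ih (hf.dirD e) (hg.dirD e)]

lemma dirD_neg (f : G → ℂ) (e : G) : dirD e (-f) = -dirD e f := by
  ext X
  simp only [dirD, Pi.neg_apply]
  rw [fderiv_neg]
  rfl

lemma dirD_iterate_sub {f g : G → ℂ} (hf : ContDiff ℝ ∞ f) (hg : ContDiff ℝ ∞ g) (e : G)
    (k : ℕ) : (dirD e)^[k] (f - g) = (dirD e)^[k] f - (dirD e)^[k] g := by
  have h : ∀ k, ∀ g : G → ℂ, (dirD e)^[k] (-g) = -(dirD e)^[k] g := by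
    intro k
    induction k with
    | zero => intro g; rfl
    | succ k ih => intro g; simp only [Function.iterate_succ_apply, dirD_neg, ih]
  rw [sub_eq_add_neg, dirD_iterate_add (g := -g) hf hg.neg, h, ← sub_eq_add_neg]

lemma dirD_mul {f g : G → ℂ} (hf : ContDiff ℝ ∞ f) (hg : ContDiff ℝ ∞ g) (e : G) :
    dirD e (f * g) = dirD e f * g + f * dirD e g := by
  ext X
  simp only [dirD, Pi.add_apply, Pi.mul_apply]
  rw [fderiv_mul (hf.differentiable (by simp)).differentiableAt
    (hg.differentiable (by simp)).differentiableAt]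
  simp
  ring

/-- A crude Leibniz bound for iterated directional derivatives. -/
lemma norm_dirD_iterate_mul_le (e : G) (X : G) {A B : ℝ} (k : ℕ) :
    ∀ f g : G → ℂ, ContDiff ℝ ∞ f → ContDiff ℝ ∞ g →
      (∀ i ≤ k, ‖(dirD e)^[i] f X‖ ≤ A) → (∀ i ≤ k, ‖(dirD e)^[i] g X‖ ≤ B) →
      ‖(dirD e)^[k] (f * g) X‖ ≤ 2 ^ k * (A * B) := by
  induction k with
  | zero =>
    intro f g hf hg hA hB'
    have h1 := hA 0 le_rfl
    have h2 := hB' 0 le_rfl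
    simp only [Function.iterate_zero, id_eq, Pi.mul_apply, norm_mul, pow_zero, one_mul] at *
    gcongr
    exact (norm_nonneg _).trans h1
  | succ k ih =>
    intro f g hf hg hA hB'
    rw [Function.iterate_succ_apply, dirD_mul hf hg,
      dirD_iterate_add (f := dirD e f * g) (g := f * dirD e g) ((hf.dirD e).mul hg)
        (hf.mul (hg.dirD e)), Pi.add_apply]
    have h1 := ih (dirD e f) g (hf.dirD e) hg
      (fun i hi => by rw [← Function.iterate_succ_apply]; exact hA _ (by omega))
      (fun i hi => hB' i (by omega))
    have h2 := ih f (dirD e g) hf (hg.dirD e) (fun i hi => hA i (by omega))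
      (fun i hi => by rw [← Function.iterate_succ_apply]; exact hB' _ (by omega))
    refine (norm_add_le _ _).trans ((add_le_add h1 h2).trans_eq ?_)
    ring

lemma dirD_iterate_comp_affine (L : H →L[ℝ] G) (Z : G) (e : H) (k : ℕ) :
    ∀ f : G → ℂ, ContDiff ℝ ∞ f → ∀ T,
      (dirD e)^[k] (fun T => f (Z + L T)) T = (dirD (L e))^[k] f (Z + L T) := by
  induction k with
  | zero => intro f _ T; rfl
  | succ k ih =>
    intro f hf T
    simp only [Function.iterate_succ_apply]
    rw [← ih _ (hf.dirD _)]
    refine congrFun (congrArg (dirD e)^[k] (funext fun T' => ?_)) T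
    simp only [dirD]
    have h1 : HasFDerivAt (fun T => Z + L T) L T' := L.hasFDerivAt.const_add Z
    have h2 := ((hf.differentiable (by simp)).differentiableAt (x := Z + L T')).hasFDerivAt
    exact congrArg (fun A : H →L[ℝ] ℂ => A e) (h2.comp T' h1).fderiv

end DirectionalDerivative

section FourierDecay

open LineDeriv

lemma SchwartzMap.coe_lineDeriv_iterate {G : Type*} [NormedAddCommGroup G] [NormedSpace ℝ G]
    (f : 𝓢(G, ℂ)) (e : G) (k : ℕ) :
    ⇑((fun f : 𝓢(G, ℂ) => ∂_{e} f)^[k] f) = (dirD e)^[k] f := by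
  induction k generalizing f with
  | zero => rfl
  | succ k ih => simp only [Function.iterate_succ_apply]; rw [ih]; rfl

variable {G : Type*} [NormedAddCommGroup G] [InnerProductSpace ℝ G] [FiniteDimensional ℝ G]
  [MeasurableSpace G] [BorelSpace G]

lemma SchwartzMap.norm_fourier_le (f : 𝓢(G, ℂ)) (P : G) : ‖𝓕 f P‖ ≤ ∫ T, ‖f T‖ := by
  rw [SchwartzMap.fourier_coe, Real.fourier_eq]
  refine (norm_integral_le_integral_norm _).trans_eq ?_
  simp

lemma SchwartzMap.pow_mul_norm_fourier_le (f : 𝓢(G, ℂ)) (e P : G) (k : ℕ) :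
    |⟪P, e⟫| ^ k * ‖𝓕 f P‖ ≤ ∫ T, ‖(dirD e)^[k] f T‖ := by
  have key : ∀ k : ℕ, ∀ f : 𝓢(G, ℂ), ‖𝓕 ((fun f : 𝓢(G, ℂ) => ∂_{e} f)^[k] f) P‖
      = (2 * π * |⟪P, e⟫|) ^ k * ‖𝓕 f P‖ := by
    intro k
    induction k with
    | zero => simp
    | succ k ih =>
      intro f
      rw [Function.iterate_succ_apply, ih, SchwartzMap.fourier_lineDerivOp_eq]
      have : Function.HasTemperateGrowth fun x : G => ⟪x, e⟫ := by fun_prop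
      rw [smul_apply, SchwartzMap.smulLeftCLM_apply_apply this]
      simp only [norm_smul, norm_mul, Complex.norm_I, Complex.norm_real, Real.norm_eq_abs,
        abs_of_pos Real.pi_pos, RCLike.norm_ofNat, mul_one]
      ring
  have h1 := SchwartzMap.norm_fourier_le ((fun f : 𝓢(G, ℂ) => ∂_{e} f)^[k] f) P
  rw [key, SchwartzMap.coe_lineDeriv_iterate] at h1
  refine le_trans ?_ h1
  gcongr
  nlinarith [Real.two_le_pi, abs_nonneg ⟪P, e⟫]

lemma SchwartzMap.integrable_one_add_norm_pow_mul (f : 𝓢(G, ℂ)) (M : ℕ) :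
    Integrable (fun T => (1 + ‖T‖) ^ M * ‖f T‖) := by
  have h1 := ((f.integrable_pow_mul volume 0).add (f.integrable_pow_mul volume M)).const_mul
    (2 ^ (M - 1))
  refine h1.mono' ?_ (Eventually.of_forall fun T => ?_)
  · have := f.continuous
    exact Continuous.aestronglyMeasurable (by fun_prop)
  · rw [Real.norm_of_nonneg (by positivity)]
    have := add_pow_le (zero_le_one (α := ℝ)) (norm_nonneg T) M
    simp only [Pi.add_apply, pow_zero, one_mul]
    rw [one_pow] at this
    calc _ ≤ 2 ^ (M - 1) * (1 + ‖T‖ ^ M) * ‖f T‖ := by gcongr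
      _ = _ := by ring

end FourierDecay

end

noncomputable section

open scoped FourierTransform ContDiff ComplexConjugate SchwartzMap

variable {n : ℕ}

/-- Phase space with its Euclidean structure. -/
abbrev Ph (n : ℕ) : Type := WithLp 2 (En n × En n)

/-- The identity from the Euclidean phase space to the product. -/
def phL (n : ℕ) : Ph n →L[ℝ] En n × En n :=
  (WithLp.prodContinuousLinearEquiv 2 ℝ (En n) (En n) : Ph n →L[ℝ] En n × En n)

/-- The standard orthonormal basis of phase space. -/
def phBasis (n : ℕ) : OrthonormalBasis (Fin n ⊕ Fin n) ℝ (Ph n) :=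
  (EuclideanSpace.basisFun (Fin n) ℝ).prod (EuclideanSpace.basisFun (Fin n) ℝ)

lemma phL_phBasis_inl (i : Fin n) :
    phL n (phBasis n (Sum.inl i)) = (EuclideanSpace.single i 1, 0) := by
  simp [phL, phBasis]

lemma phL_phBasis_inr (i : Fin n) :
    phL n (phBasis n (Sum.inr i)) = (0, EuclideanSpace.single i 1) := by
  simp [phL, phBasis]

lemma norm_phL_snd_le (T : Ph n) : ‖(phL n T).2‖ ≤ ‖T‖ := WithLp.norm_snd_le _ T

lemma norm_phL_fst_le (T : Ph n) : ‖(phL n T).1‖ ≤ ‖T‖ := WithLp.norm_fst_le _ T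

/-- A nonnegative weight is temperate with constants `A`, `M`. -/
def Temperate (A : ℝ) (M : ℕ) (w : En n → ℝ) : Prop :=
  (∀ ξ, 0 ≤ w ξ) ∧ ∀ ξ t, w (ξ + t) ≤ A * (1 + ‖t‖) ^ M * w ξ

lemma OrthonormalBasis.one_add_norm_pow_mul_le {ι G : Type*} [Fintype ι] [NormedAddCommGroup G]
    [InnerProductSpace ℝ G] (e : OrthonormalBasis ι ℝ G) (P : G) (k : ℕ) {a : ℝ} (ha : 0 ≤ a) :
    (1 + ‖P‖) ^ (k + 1) * a ≤ 2 ^ k * (1 + (Fintype.card ι) ^ k) *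
      (a + ∑ i, |⟪P, e i⟫| ^ (k + 1) * a) := by
  have h1 : ‖P‖ ≤ ∑ i, |⟪P, e i⟫| := by
    conv_lhs => rw [← e.sum_repr' P]
    refine (norm_sum_le _ _).trans (Finset.sum_le_sum fun i _ => ?_)
    rw [norm_smul, e.norm_eq_one, mul_one, Real.norm_eq_abs, real_inner_comm]
  have h2 : ‖P‖ ^ (k + 1) ≤ (Fintype.card ι) ^ k * ∑ i, |⟪P, e i⟫| ^ (k + 1) :=
    (pow_le_pow_left₀ (norm_nonneg P) h1 _).trans
      (pow_sum_le_card_mul_sum_pow (fun _ _ => abs_nonneg _) k)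
  have h3 := add_pow_le (zero_le_one (α := ℝ)) (norm_nonneg P) (k + 1)
  rw [one_pow, Nat.add_sub_cancel] at h3
  set S := ∑ i, |⟪P, e i⟫| ^ (k + 1)
  have hS : 0 ≤ S := Finset.sum_nonneg fun i _ => by positivity
  rw [← Finset.sum_mul]
  have hc : (0 : ℝ) ≤ (Fintype.card ι : ℝ) ^ k := by positivity
  calc (1 + ‖P‖) ^ (k + 1) * a ≤ 2 ^ k * (1 + (Fintype.card ι) ^ k * S) * a := by
        gcongr; exact h3.trans (by gcongr)
    _ ≤ 2 ^ k * ((1 + (Fintype.card ι) ^ k) * (1 + S)) * a := by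
        gcongr; nlinarith
    _ = _ := by ring

lemma integrable_sum_dirD (Φ : 𝓢(Ph n, ℂ)) (e : Ph n) (k M : ℕ) :
    Integrable (fun T => (1 + ‖T‖) ^ M * ∑ i ∈ Finset.range (k + 1), ‖(dirD e)^[i] Φ T‖) := by
  simp_rw [Finset.mul_sum]
  refine integrable_finsetSum _ fun i _ => ?_
  rw [← SchwartzMap.coe_lineDeriv_iterate]
  exact SchwartzMap.integrable_one_add_norm_pow_mul _ M

/-- Fourier decay in one direction for a localised symbol. -/
lemma fourier_localised_dir (Φ : 𝓢(Ph n, ℂ)) {A : ℝ} (hA : 0 ≤ A) (M : ℕ) (e : Ph n) (k : ℕ) :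
    ∃ C, 0 ≤ C ∧ ∀ (b : En n × En n → ℂ) (w : En n → ℝ), ContDiff ℝ ∞ b → Temperate A M w →
      (∀ i ≤ k, ∀ X, ‖(dirD (phL n e))^[i] b X‖ ≤ w X.2) →
      ∀ (Z : En n × En n) (β : 𝓢(Ph n, ℂ)), (∀ T, β T = b (Z + phL n T) * Φ T) →
      ∀ P, |⟪P, e⟫| ^ k * ‖𝓕 β P‖ ≤ C * w Z.2 := by
  refine ⟨max 0 (2 ^ k * A * ∫ T : Ph n, (1 + ‖T‖) ^ M *
    ∑ i ∈ Finset.range (k + 1), ‖(dirD e)^[i] Φ T‖), le_max_left _ _, ?_⟩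
  intro b w hb hw hbd Z β hβ P
  refine (SchwartzMap.pow_mul_norm_fourier_le β e P k).trans ?_
  have hb' : ContDiff ℝ ∞ (fun T => b (Z + phL n T)) :=
    hb.comp (contDiff_const.add (phL n).contDiff)
  have hβ' : (β : Ph n → ℂ) = (fun T => b (Z + phL n T)) * Φ := funext hβ
  calc ∫ T, ‖(dirD e)^[k] β T‖
      ≤ ∫ T : Ph n, (2 ^ k * A * w Z.2) * ((1 + ‖T‖) ^ M *
          ∑ i ∈ Finset.range (k + 1), ‖(dirD e)^[i] Φ T‖) := by
        refine integral_mono_of_nonneg (Eventually.of_forall fun _ => norm_nonneg _)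
          ((integrable_sum_dirD Φ e k M).const_mul _) (Eventually.of_forall fun T => ?_)
        have h1 := norm_dirD_iterate_mul_le e T (A := w (Z + phL n T).2)
          (B := ∑ i ∈ Finset.range (k + 1), ‖(dirD e)^[i] Φ T‖) k
          (fun T => b (Z + phL n T)) Φ hb' (Φ.smooth ⊤)
          (fun i hi => by
            rw [dirD_iterate_comp_affine (phL n) Z e i b hb]; exact hbd i hi _)
          (fun i hi => Finset.single_le_sum (f := fun i => ‖(dirD e)^[i] Φ T‖)
            (fun _ _ => norm_nonneg _) (Finset.mem_range.2 (by omega)))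
        simp only [hβ']
        refine h1.trans ?_
        have h2 : w (Z + phL n T).2 ≤ A * (1 + ‖T‖) ^ M * w Z.2 := by
          refine (hw.2 Z.2 (phL n T).2).trans ?_
          have := hw.1 Z.2
          gcongr
          exact norm_phL_snd_le T
        have h3 : 0 ≤ ∑ i ∈ Finset.range (k + 1), ‖(dirD e)^[i] Φ T‖ :=
          Finset.sum_nonneg fun _ _ => norm_nonneg _
        calc _ ≤ 2 ^ k * ((A * (1 + ‖T‖) ^ M * w Z.2) *
              ∑ i ∈ Finset.range (k + 1), ‖(dirD e)^[i] Φ T‖) := by gcongr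
          _ = _ := by ring
    _ = 2 ^ k * A * (∫ T : Ph n, (1 + ‖T‖) ^ M *
          ∑ i ∈ Finset.range (k + 1), ‖(dirD e)^[i] Φ T‖) * w Z.2 := by
        rw [integral_const_mul]; ring
    _ ≤ _ := by
        gcongr
        · exact hw.1 _
        · exact le_max_right _ _

/-- The directional bounds on pure derivatives required of a symbol. -/
def PureBound (k : ℕ) (b : En n × En n → ℂ) (w : En n → ℝ) : Prop :=
  ∀ j : Fin n ⊕ Fin n, ∀ i ≤ k, ∀ X, ‖(dirD (phL n (phBasis n j)))^[i] b X‖ ≤ w X.2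

lemma fourier_localised_decay (Φ : 𝓢(Ph n, ℂ)) {A : ℝ} (hA : 0 ≤ A) (M K : ℕ) :
    ∃ C, 0 ≤ C ∧ ∀ (b : En n × En n → ℂ) (w0 w1 w : En n → ℝ), ContDiff ℝ ∞ b →
      Temperate A M w0 → Temperate A M w1 → (∀ ξ, 0 ≤ w ξ) → (∀ ξ, w0 ξ * w1 ξ ≤ w ξ ^ 2) →
      (∀ X, ‖b X‖ ≤ w0 X.2) → PureBound (2 * K + 2) b w1 →
      (∀ X, ‖b X‖ ≤ w1 X.2) →
      ∀ (Z : En n × En n) (β : 𝓢(Ph n, ℂ)), (∀ T, β T = b (Z + phL n T) * Φ T) →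
      ∀ P, (1 + ‖P‖) ^ (K + 1) * ‖𝓕 β P‖ ≤ C * w Z.2 := by
  obtain ⟨C0, hC0, h0⟩ := fourier_localised_dir Φ hA M 0 0
  choose C1 hC1 h1 using fun j => fourier_localised_dir Φ hA M (phBasis n j) (2 * K + 2)
  set D := 2 ^ (2 * K + 1) * (1 + (Fintype.card (Fin n ⊕ Fin n) : ℝ) ^ (2 * K + 1)) *
      (C0 + ∑ j, C1 j) with hD
  have hS : 0 ≤ ∑ j, C1 j := Finset.sum_nonneg fun j _ => hC1 j
  have hD0 : 0 ≤ D := by positivity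
  refine ⟨√(C0 * D), by positivity, ?_⟩
  intro b w0 w1 w hb hw0 hw1 hw hww hb0 hb1 hb1' Z β hβ P
  have e : ∀ w : En n → ℝ, Temperate A M w → (∀ X, ‖b X‖ ≤ w X.2) → ‖𝓕 β P‖ ≤ C0 * w Z.2 := by
    intro w hw hbw
    have := h0 b w hb hw (fun i hi X => by
      obtain rfl : i = 0 := by omega
      exact hbw X) Z β hβ P
    simpa using this
  have e0 := e w0 hw0 hb0
  have e1 : (1 + ‖P‖) ^ (2 * K + 2) * ‖𝓕 β P‖ ≤ D * w1 Z.2 := by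
    refine ((phBasis n).one_add_norm_pow_mul_le P (2 * K + 1) (norm_nonneg _)).trans ?_
    have : ‖𝓕 β P‖ + ∑ j, |⟪P, phBasis n j⟫| ^ (2 * K + 1 + 1) * ‖𝓕 β P‖
        ≤ C0 * w1 Z.2 + ∑ j, C1 j * w1 Z.2 := by
      refine add_le_add (e w1 hw1 hb1') (Finset.sum_le_sum fun j _ =>
        h1 j b w1 hb hw1 (hb1 j) Z β hβ P)
    rw [← Finset.sum_mul (s := Finset.univ) (f := C1), ← add_mul] at this
    rw [hD, mul_assoc _ _ (w1 Z.2)]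
    gcongr
  refine abs_le_of_sq_le_sq' ?_ (by have := hw Z.2; positivity) |>.2
  have := hw0.1 Z.2
  have := hw1.1 Z.2
  calc ((1 + ‖P‖) ^ (K + 1) * ‖𝓕 β P‖) ^ 2
      = ‖𝓕 β P‖ * ((1 + ‖P‖) ^ (2 * K + 2) * ‖𝓕 β P‖) := by ring
    _ ≤ (C0 * w0 Z.2) * (D * w1 Z.2) := by gcongr
    _ = C0 * D * (w0 Z.2 * w1 Z.2) := by ring
    _ ≤ C0 * D * w Z.2 ^ 2 := by gcongr; exact hww _
    _ = _ := by rw [mul_pow, Real.sq_sqrt (by positivity)]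

end

noncomputable section

open scoped FourierTransform ContDiff ComplexConjugate SchwartzMap

variable {n : ℕ}

/-- A real-valued window that does not vanish identically. -/
def IsWindow (g : 𝓢(En n, ℂ)) : Prop := (∀ y, conj (g y) = g y) ∧ 0 < ∫ y, ‖g y‖ ^ 2

lemma exists_isWindow (n : ℕ) : ∃ g : 𝓢(En n, ℂ), IsWindow g := by
  let f : ContDiffBump (0 : En n) := default
  have hs : HasCompactSupport (fun y => (f y : ℂ)) :=
    f.hasCompactSupport.comp_left (g := fun t : ℝ => (t : ℂ)) (by simp)
  have hd : ContDiff ℝ ∞ (fun y => (f y : ℂ)) := Complex.ofRealCLM.contDiff.comp f.contDiff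
  refine ⟨hs.toSchwartzMap hd, fun y => Complex.conj_ofReal _, ?_⟩
  set g := hs.toSchwartzMap hd
  rw [integral_pos_iff_support_of_nonneg (fun _ => by positivity) g.integrable_norm_sq]
  have hc : Continuous fun y => ‖g y‖ ^ 2 := by have := g.continuous; fun_prop
  refine (hc.isOpen_support).measure_pos volume ⟨0, ?_⟩
  have : g 0 = f 0 := rfl
  have h1 : f 0 = 1 := f.one_of_mem_closedBall (by simp [f.rIn_pos.le])
  simp [this, h1]

lemma integrable_winR (g : 𝓢(En n, ℂ)) : Integrable (winR g) := by
  have h := (g.integrable (μ := volume)).mul_prod ((oscS g).integrable (μ := volume))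
  rw [Measure.volume_eq_prod]
  refine h.mono ?_ (Eventually.of_forall fun q => ?_)
  · have := g.continuous
    have := (oscS g).continuous
    unfold winR
    exact Continuous.aestronglyMeasurable (by fun_prop)
  · simp [winR]

lemma integral_winR (g : 𝓢(En n, ℂ)) (hg : ∀ y, conj (g y) = g y) :
    ∫ Y, winR g Y = ((2 * π) ^ n * ∫ y, ‖g y‖ ^ 2 : ℝ) := by
  have h := integrable_winR g
  rw [Measure.volume_eq_prod] at h ⊢
  rw [integral_prod _ h]
  push_cast
  rw [← integral_complex_ofReal, ← integral_const_mul]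
  congr 1 with y
  have h1 := osc_oscS_neg g y
  have h2 : ((‖g y‖ ^ 2 : ℝ) : ℂ) = g y * g y := by
    rw [Complex.ofReal_pow, ← Complex.mul_conj', hg]
  rw [h2, ← mul_assoc, ← h1, osc, ← integral_mul_const]
  congr 1 with η
  simp only [winR, inner_neg_right, real_inner_comm y η]
  ring

lemma continuous_winR (g : 𝓢(En n, ℂ)) : Continuous (winR g) := by
  have := g.continuous
  have := (oscS g).continuous
  unfold winR
  fun_prop

lemma continuous_Rk (u v : 𝓢(En n, ℂ)) : Continuous (Rk u v) := by
  have := u.continuous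
  have := v.continuous
  unfold Rk
  exact ((by fun_prop : Continuous fun X : En n × En n => cis ⟪X.1, X.2⟫ * v X.2)).mul
    (Complex.continuous_conj.comp (by fun_prop))

lemma norm_Rk (u v : 𝓢(En n, ℂ)) (X : En n × En n) : ‖Rk u v X‖ = ‖u X.1‖ * ‖v X.2‖ := by
  simp [Rk, mul_comm]

lemma integrable_pow_mul_norm_Rk (u v : 𝓢(En n, ℂ)) (M : ℕ) :
    Integrable (fun X : En n × En n => (1 + ‖X.2‖) ^ M * ‖Rk u v X‖) := by
  have h := (u.integrable (μ := volume)).norm.mul_prod (v.integrable_one_add_norm_pow_mul M)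
  rw [Measure.volume_eq_prod]
  refine h.congr (Eventually.of_forall fun X => ?_)
  simp only [norm_Rk]
  ring

lemma integrable_mul_Rk (u v : 𝓢(En n, ℂ)) {b : En n × En n → ℂ} (hb : Continuous b) {A : ℝ}
    {M : ℕ} (hA : ∀ X, ‖b X‖ ≤ A * (1 + ‖X.2‖) ^ M) : Integrable (fun X => b X * Rk u v X) := by
  refine ((integrable_pow_mul_norm_Rk u v M).const_mul A).mono'
    (hb.mul (continuous_Rk u v)).aestronglyMeasurable (Eventually.of_forall fun X => ?_)
  rw [norm_mul, ← mul_assoc]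
  gcongr
  exact hA X

/-- A compactly supported companion of `winR g` with nonvanishing pairing. -/
lemma exists_companion (g : 𝓢(En n, ℂ)) (hg : IsWindow g) :
    ∃ Φ : 𝓢(Ph n, ℂ), HasCompactSupport Φ ∧
      ∫ T : En n × En n, Φ (WithLp.toLp 2 T) * winR g T ≠ 0 := by
  have h1 : ∃ Y, winR g Y ≠ 0 := by
    by_contra! h
    have h2 := integral_winR g hg.1
    simp only [h, integral_zero] at h2
    have h3 : 0 < (2 * π) ^ n * ∫ y, ‖g y‖ ^ 2 := mul_pos (by positivity) hg.2
    have h4 : (0 : ℝ) = (2 * π) ^ n * ∫ y, ‖g y‖ ^ 2 := by exact_mod_cast h2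
    linarith
  obtain ⟨Y, hY⟩ := h1
  let f : ContDiffBump (WithLp.toLp 2 Y : Ph n) := default
  let F : Ph n → ℂ := fun T => f T * conj (winR g (WithLp.ofLp T))
  have hwin : ContDiff ℝ ∞ (fun T : Ph n => conj (winR g (WithLp.ofLp T))) := by
    have h0 : ContDiff ℝ ∞ (winR g) := by
      unfold winR cis
      have hg1 : ContDiff ℝ ∞ fun Y : En n × En n => g Y.1 := (g.smooth ⊤).comp contDiff_fst
      have hg2 : ContDiff ℝ ∞ fun Y : En n × En n => oscS g Y.2 :=
        ((oscS g).smooth ⊤).comp contDiff_snd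
      have hg3 : ContDiff ℝ ∞ fun Y : En n × En n => Complex.exp (Complex.I * (-⟪Y.1, Y.2⟫ : ℝ)) := by
        refine ContDiff.cexp (contDiff_const.mul (Complex.ofRealCLM.contDiff.comp ?_))
        exact (contDiff_fst.inner ℝ contDiff_snd).neg
      exact (hg3.mul hg1).mul hg2
    exact Complex.conjCLE.contDiff.comp (h0.comp (phL n).contDiff)
  have hd : ContDiff ℝ ∞ F := (Complex.ofRealCLM.contDiff.comp f.contDiff).mul hwin
  have hs : HasCompactSupport F :=
    (f.hasCompactSupport.comp_left (g := fun t : ℝ => (t : ℂ)) (by simp)).mul_right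
  refine ⟨hs.toSchwartzMap hd, hs, ?_⟩
  have e : ∀ T : En n × En n, (hs.toSchwartzMap hd) (WithLp.toLp 2 T) * winR g T
      = ((f (WithLp.toLp 2 T) * ‖winR g T‖ ^ 2 : ℝ) : ℂ) := by
    intro T
    have : (hs.toSchwartzMap hd) (WithLp.toLp 2 T)
        = f (WithLp.toLp 2 T) * conj (winR g T) := rfl
    rw [this, mul_assoc, Complex.conj_mul']
    push_cast
    ring
  simp_rw [e]
  rw [integral_complex_ofReal, Complex.ofReal_ne_zero]
  have hcont : Continuous fun T : En n × En n => f (WithLp.toLp 2 T : Ph n) * ‖winR g T‖ ^ 2 := by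
    have h1 : Continuous fun T : En n × En n => f (WithLp.toLp 2 T : Ph n) :=
      f.continuous.comp (WithLp.prodContinuousLinearEquiv 2 ℝ (En n) (En n)).symm.continuous
    exact h1.mul ((continuous_winR g).norm.pow 2)
  have hcs : HasCompactSupport
      (fun T : En n × En n => f (WithLp.toLp 2 T : Ph n) * ‖winR g T‖ ^ 2) := by
    have h1 : HasCompactSupport fun T : En n × En n => f (WithLp.toLp 2 T : Ph n) :=
      f.hasCompactSupport.comp_homeomorph
        (WithLp.prodContinuousLinearEquiv 2 ℝ (En n) (En n)).symm.toHomeomorph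
    exact h1.mul_right
  have hnn : 0 ≤ fun T : En n × En n => f (WithLp.toLp 2 T : Ph n) * ‖winR g T‖ ^ 2 :=
    fun T => mul_nonneg f.nonneg (by positivity)
  refine ((integral_pos_iff_support_of_nonneg hnn (hcont.integrable_of_hasCompactSupport hcs)).2
    ((hcont.isOpen_support).measure_pos volume ⟨Y, ?_⟩)).ne'
  have : f (WithLp.toLp 2 Y : Ph n) = 1 := f.one_of_mem_closedBall (by simp [f.rIn_pos.le])
  simp [this, hY]

end

noncomputable section

open scoped FourierTransform ContDiff ComplexConjugate SchwartzMap

variable {n : ℕ}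

instance : (volume : Measure (En n × En n)).IsAddHaarMeasure := by
  rw [Measure.volume_eq_prod]; infer_instance

lemma lintegral_enorm_sq_mul_pow_ne_top (f : 𝓢(En n, ℂ)) (M : ℕ) :
    ∫⁻ t, ‖f t‖ₑ ^ 2 * ENNReal.ofReal ((1 + ‖t‖) ^ M) ≠ ⊤ := by
  obtain ⟨C, hC0, hC⟩ := f.exists_bound
  have h := ((f.integrable_one_add_norm_pow_mul M).const_mul C).lintegral_lt_top
  refine ne_top_of_le_ne_top h.ne (lintegral_mono fun t => ?_)
  rw [← ofReal_norm, ← ENNReal.ofReal_pow (norm_nonneg _), ← ENNReal.ofReal_mul (by positivity)]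
  refine ENNReal.ofReal_le_ofReal ?_
  calc ‖f t‖ ^ 2 * (1 + ‖t‖) ^ M = ‖f t‖ * ((1 + ‖t‖) ^ M * ‖f t‖) := by ring
    _ ≤ _ := by gcongr; exact hC t

/-- Passing from the short-time transform back to the function, with a temperate weight. -/
lemma lintegral_weight_Vk_le (g : 𝓢(En n, ℂ)) {A : ℝ} (hA : 0 ≤ A) (M : ℕ) {κ : ℝ} (hκ : 0 < κ) :
    ∃ C : ℝ≥0∞, C ≠ ⊤ ∧ ∀ (v : 𝓢(En n, ℂ)) (w : En n → ℝ), Continuous w → Temperate A M w →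
      ∫⁻ ξ, ENNReal.ofReal (w ξ) * ∫⁻ x, ‖Vk g v κ x ξ‖ₑ ^ 2 ≤
        C * ∫⁻ ξ, ENNReal.ofReal (w ξ) * ‖v ξ‖ₑ ^ 2 := by
  refine ⟨ENNReal.ofReal ((2 * π / κ) ^ n) * (ENNReal.ofReal (A * (1 + κ) ^ M) *
    ∫⁻ t, ‖oscS g t‖ₑ ^ 2 * ENNReal.ofReal ((1 + ‖t‖) ^ M)),
    ENNReal.mul_ne_top ENNReal.ofReal_ne_top (ENNReal.mul_ne_top ENNReal.ofReal_ne_top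
      (lintegral_enorm_sq_mul_pow_ne_top _ _)), ?_⟩
  intro v w hwc hw
  rw [lintegral_weight_Vk g v hκ _ (by fun_prop), mul_assoc]
  gcongr
  have hv := v.continuous
  rw [← lintegral_const_mul _ (by fun_prop)]
  refine lintegral_mono fun ζ => ?_
  have h1 : ∀ t, ENNReal.ofReal (w (ζ - κ • t)) ≤ ENNReal.ofReal (A * (1 + κ) ^ M) *
      ENNReal.ofReal ((1 + ‖t‖) ^ M) * ENNReal.ofReal (w ζ) := by
    intro t
    have := hw.1 ζ
    rw [← ENNReal.ofReal_mul (by positivity), ← ENNReal.ofReal_mul (by positivity)]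
    refine ENNReal.ofReal_le_ofReal ?_
    rw [sub_eq_add_neg]
    refine (hw.2 ζ _).trans ?_
    rw [mul_assoc A ((1 + κ) ^ M), ← mul_pow]
    gcongr
    rw [norm_neg, norm_smul, Real.norm_of_nonneg hκ.le]
    nlinarith [norm_nonneg t]
  calc ‖v ζ‖ₑ ^ 2 * ∫⁻ t, ‖oscS g t‖ₑ ^ 2 * ENNReal.ofReal (w (ζ - κ • t))
      ≤ ‖v ζ‖ₑ ^ 2 * ∫⁻ t, (ENNReal.ofReal (A * (1 + κ) ^ M) * ENNReal.ofReal (w ζ)) *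
        (‖oscS g t‖ₑ ^ 2 * ENNReal.ofReal ((1 + ‖t‖) ^ M)) := by
        refine mul_le_mul_right (lintegral_mono fun t => ?_) _
        refine (mul_le_mul_right (h1 t) _).trans_eq ?_
        ring
    _ = _ := by
        have := (oscS g).continuous
        rw [lintegral_const_mul _ (by fun_prop)]
        ring

lemma two_mul_le_sq_add_sq_ennreal (a b : ℝ≥0∞) : a * b ≤ a ^ 2 + b ^ 2 := by
  rcases le_total a b with h | h
  · exact (mul_le_mul_left h b).trans (by rw [← sq]; exact le_add_self)
  · exact (mul_le_mul_right h a).trans (by rw [← sq]; exact le_self_add)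

/-- Two shifts of a square-integrable function on phase space, paired against a weight. -/
lemma lintegral_shifted_mul_le {F : En n × En n → ℝ≥0∞} (hF : Measurable F) {W : En n → ℝ≥0∞}
    (hW : Measurable W) {B : ℝ≥0∞} (p q : En n) (hB : ∀ ξ, W (ξ + p) ≤ B * W ξ) :
    ∫⁻ Z : En n × En n, W Z.2 * (F (Z.1, Z.2 - p) * F (Z.1 - q, Z.2)) ≤
      (B + 1) * ∫⁻ ξ, W ξ * ∫⁻ x, F (x, ξ) ^ 2 := by
  have m2F : Measurable fun Z => F Z ^ 2 := hF.pow_const 2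
  have mN : Measurable fun ξ => ∫⁻ x, F (x, ξ) ^ 2 := m2F.lintegral_prod_left'
  generalize hN : (fun ξ => ∫⁻ x, F (x, ξ) ^ 2) = N at mN
  have hN' : ∀ ξ, ∫⁻ x, F (x, ξ) ^ 2 = N ξ := fun ξ => congrFun hN ξ
  have m1 : Measurable fun Z : En n × En n => W Z.2 * F (Z.1, Z.2 - p) ^ 2 := by fun_prop
  have m2 : Measurable fun Z : En n × En n => W Z.2 * F (Z.1 - q, Z.2) ^ 2 := by fun_prop
  have e1 : ∫⁻ Z : En n × En n, W Z.2 * F (Z.1, Z.2 - p) ^ 2 = ∫⁻ ξ, W ξ * N (ξ - p) := by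
    rw [Measure.volume_eq_prod, lintegral_prod_symm' _ m1]
    refine lintegral_congr fun ξ => ?_
    change ∫⁻ x, W ξ * F (x, ξ - p) ^ 2 = _
    rw [lintegral_const_mul (W ξ) (f := fun x => F (x, ξ - p) ^ 2) (by fun_prop), hN']
  have e2 : ∫⁻ Z : En n × En n, W Z.2 * F (Z.1 - q, Z.2) ^ 2 = ∫⁻ ξ, W ξ * N ξ := by
    rw [Measure.volume_eq_prod, lintegral_prod_symm' _ m2]
    refine lintegral_congr fun ξ => ?_
    change ∫⁻ x, W ξ * F (x - q, ξ) ^ 2 = _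
    rw [lintegral_const_mul (W ξ) (f := fun x => F (x - q, ξ) ^ 2) (by fun_prop),
      lintegral_sub_right_eq_self (fun x => F (x, ξ) ^ 2), hN']
  have e3 : ∫⁻ ξ, W ξ * N (ξ - p) ≤ B * ∫⁻ ξ, W ξ * N ξ := by
    rw [← lintegral_add_right_eq_self _ p, ← lintegral_const_mul B (f := fun ξ => W ξ * N ξ) (by fun_prop)]
    refine lintegral_mono fun ξ => ?_
    rw [add_sub_cancel_right, ← mul_assoc]
    exact mul_le_mul_left (hB ξ) _
  simp only [hN']
  calc ∫⁻ Z : En n × En n, W Z.2 * (F (Z.1, Z.2 - p) * F (Z.1 - q, Z.2))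
      ≤ ∫⁻ Z : En n × En n, (W Z.2 * F (Z.1, Z.2 - p) ^ 2 + W Z.2 * F (Z.1 - q, Z.2) ^ 2) := by
        refine lintegral_mono fun Z => ?_
        rw [← mul_add]
        exact mul_le_mul_right (two_mul_le_sq_add_sq_ennreal _ _) _
    _ = (∫⁻ ξ, W ξ * N (ξ - p)) + ∫⁻ ξ, W ξ * N ξ := by
        rw [lintegral_add_left m1, e1, e2]
    _ ≤ B * (∫⁻ ξ, W ξ * N ξ) + ∫⁻ ξ, W ξ * N ξ := by gcongr
    _ = _ := by rw [add_mul, one_mul]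

/-- Fourier inversion inside an integral over phase space. -/
lemma integral_schwartz_mul (β : 𝓢(Ph n, ℂ)) {G : En n × En n → ℂ} (hG : Integrable G) :
    ∫ T : En n × En n, β (WithLp.toLp 2 T) * G T =
      ∫ P : Ph n, (𝓕⁻ β : 𝓢(Ph n, ℂ)) P *
        ∫ T : En n × En n, cis (⟪-(2 * π) • P.fst, T.1⟫ + ⟪-(2 * π) • P.snd, T.2⟫) * G T := by
  set B : 𝓢(Ph n, ℂ) := 𝓕⁻ β with hB
  have hβ : ∀ T : En n × En n, β (WithLp.toLp 2 T) =
      ∫ P : Ph n, cis (⟪-(2 * π) • P.fst, T.1⟫ + ⟪-(2 * π) • P.snd, T.2⟫) * B P := by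
    intro T
    have h2 : β (WithLp.toLp 2 T) = 𝓕 B (WithLp.toLp 2 T) := by simp [hB]
    rw [h2, SchwartzMap.fourier_coe, Real.fourier_eq']
    congr 1 with P
    simp only [cis, smul_eq_mul, WithLp.prod_inner_apply, real_inner_smul_left]
    congr 2
    push_cast
    simp
    ring
  calc _ = ∫ T : En n × En n, ∫ P : Ph n,
        cis (⟪-(2 * π) • P.fst, T.1⟫ + ⟪-(2 * π) • P.snd, T.2⟫) * B P * G T := by
        congr 1 with T
        rw [hβ, integral_mul_const]
    _ = ∫ P : Ph n, ∫ T : En n × En n,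
        cis (⟪-(2 * π) • P.fst, T.1⟫ + ⟪-(2 * π) • P.snd, T.2⟫) * B P * G T := by
        rw [integral_integral_swap]
        have h := hG.mul_prod (B.integrable (μ := volume))
        refine h.mono ?_ (Eventually.of_forall fun q => ?_)
        · have h1 : Continuous fun q : (En n × En n) × Ph n =>
              cis (⟪-(2 * π) • q.2.fst, q.1.1⟫ + ⟪-(2 * π) • q.2.snd, q.1.2⟫) * B q.2 := by
            have := B.continuous
            have := (WithLp.prod_continuous_ofLp 2 (En n) (En n))
            have h3 : Continuous fun P : Ph n => P.fst := continuous_fst.comp this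
            have h4 : Continuous fun P : Ph n => P.snd := continuous_snd.comp this
            fun_prop
          exact h1.aestronglyMeasurable.mul
            (hG.aestronglyMeasurable.comp_fst)
        · simp [Function.uncurry_def, mul_comm]
    _ = _ := by
        congr 1 with P
        rw [← integral_const_mul]
        congr 1 with T
        ring

/-- Averaging an integral over translates. -/
lemma integral_mul_integral_translate {F Ψ : En n × En n → ℂ} (hF : Integrable F)
    (hΨ : Integrable Ψ) :
    (∫ T, Ψ T) * ∫ X, F X = ∫ Z, ∫ T, Ψ T * F (Z + T) := by
  have h1 : Integrable (fun q : (En n × En n) × (En n × En n) => Ψ q.2 * F (q.1 + q.2))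
      (volume.prod volume) := by
    have h2 := (measurePreserving_prod_add (volume : Measure (En n × En n))
      (volume : Measure (En n × En n)))
    have h3 := (hΨ.mul_prod hF)
    have h4 := (h2.integrable_comp h3.aestronglyMeasurable).2 h3
    have h5 := h4.swap
    refine h5.congr (Eventually.of_forall fun q => ?_)
    simp [add_comm]
  rw [integral_integral_swap h1, ← integral_mul_const]
  congr 1 with T
  rw [integral_const_mul, integral_add_right_eq_self (fun Z => F Z)]

end

noncomputable section

open scoped FourierTransform ContDiff ComplexConjugate SchwartzMap

variable {n : ℕ}

lemma norm_Uk_one (g u : 𝓢(En n, ℂ)) (x ξ : En n) :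
    ‖Uk g u 1 x ξ‖ = cn n * ‖Vk g (ftS u) 1 x ξ‖ := by
  rw [Uk_eq g u one_pos]
  simp [abs_of_pos (cn_pos (n := n))]

lemma integrable_winR_mul_Rk (g u v : 𝓢(En n, ℂ)) (Z : En n × En n) :
    Integrable fun T : En n × En n => winR g T * Rk u v (Z + T) := by
  obtain ⟨C, hC0, hC⟩ := u.exists_bound
  obtain ⟨D, hD0, hD⟩ := v.exists_bound
  have := continuous_Rk u v
  refine (integrable_winR g).mul_bdd (c := C * D) ?_ (Eventually.of_forall fun T => ?_)
  · exact Continuous.aestronglyMeasurable (by fun_prop)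
  · rw [norm_Rk]
    exact mul_le_mul (hC _) (hD _) (norm_nonneg _) hC0

/-- The localised pairing is controlled by the short-time transforms. -/
lemma enorm_integral_localised_le (g u : 𝓢(En n, ℂ)) (hg : IsWindow g) (β : 𝓢(Ph n, ℂ))
    (Z : En n × En n) {h : Ph n → ℝ} (hβ : ∀ P, ‖𝓕 β P‖ ≤ h (-P)) :
    ‖∫ T : En n × En n, β (WithLp.toLp 2 T) * (winR g T * Rk u (ftS u) (Z + T))‖ₑ ≤
      ∫⁻ P : Ph n, ENNReal.ofReal (cn n * h P) *
        (‖Vk g (ftS u) 1 Z.1 (Z.2 - (2 * π) • P.fst)‖ₑ *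
          ‖Vk g (ftS u) 1 (Z.1 - (2 * π) • P.snd) Z.2‖ₑ) := by
  rw [integral_schwartz_mul β (integrable_winR_mul_Rk g u (ftS u) Z)]
  refine (enorm_integral_le_lintegral_enorm _).trans (lintegral_mono fun P => ?_)
  have h1 := integral_winR_mul_Rk g u (ftS u) hg.1 one_pos Z.1 Z.2 (-(2 * π) • P.fst)
    (-(2 * π) • P.snd)
  simp only [inv_one, one_smul, neg_smul, ← sub_eq_add_neg] at h1
  have h2 : ∀ T : En n × En n, Z + T = (Z.1 + T.1, Z.2 + T.2) := fun T => rfl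
  simp only [h2, neg_smul, h1]
  have h3 : ‖(𝓕⁻ β : 𝓢(Ph n, ℂ)) P‖ ≤ h P := by
    have : (𝓕⁻ β : 𝓢(Ph n, ℂ)) P = (𝓕 β : 𝓢(Ph n, ℂ)) (-P) := by
      rw [SchwartzMap.fourierInv_coe, SchwartzMap.fourier_coe, Real.fourierInv_eq_fourier_neg]
    rw [this]
    simpa using hβ (-P)
  have hh := (norm_nonneg _).trans h3
  have hc := (cn_pos (n := n)).le
  simp only [← ofReal_norm]
  rw [← ENNReal.ofReal_mul (norm_nonneg _), ← ENNReal.ofReal_mul (by positivity)]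
  refine ENNReal.ofReal_le_ofReal ?_
  rw [norm_mul, norm_mul, norm_mul, norm_cis, RCLike.norm_conj, norm_Uk_one, one_mul]
  calc _ ≤ h P * (cn n * ‖Vk g (ftS u) 1 Z.1 (Z.2 - (2 * π) • P.fst)‖ *
      ‖Vk g (ftS u) 1 (Z.1 - (2 * π) • P.snd) Z.2‖) := by gcongr
    _ = _ := by ring

lemma finrank_Ph (n : ℕ) : Module.finrank ℝ (Ph n) = 2 * n := by
  rw [(WithLp.linearEquiv 2 ℝ (En n × En n)).finrank_eq]
  simp [two_mul]

lemma lintegral_decay_ne_top (n : ℕ) :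
    ∫⁻ P : Ph n, ENNReal.ofReal (((1 + ‖P‖) ^ (2 * n + 1))⁻¹) ≠ ⊤ := by
  have h := integrable_one_add_norm (E := Ph n) (μ := volume) (r := 2 * n + 1)
    (by rw [finrank_Ph]; push_cast; linarith)
  refine ne_top_of_le_ne_top h.lintegral_lt_top.ne (lintegral_mono fun P => ?_)
  refine ENNReal.ofReal_le_ofReal (le_of_eq ?_)
  rw [Real.rpow_neg (by positivity)]
  norm_cast

/-- The pairing with a symbol averaged over phase-space translates. -/
lemma integral_companion_mul (g u : 𝓢(En n, ℂ)) (Φ : 𝓢(Ph n, ℂ)) {b : En n × En n → ℂ}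
    (hb : Integrable fun X => b X * Rk u (ftS u) X) :
    (∫ T : En n × En n, Φ (WithLp.toLp 2 T) * winR g T) * ∫ X, b X * Rk u (ftS u) X =
      ∫ Z, ∫ T : En n × En n, (b (Z + T) * Φ (WithLp.toLp 2 T)) *
        (winR g T * Rk u (ftS u) (Z + T)) := by
  obtain ⟨C, hC0, hC⟩ : ∃ C, 0 ≤ C ∧ ∀ x, ‖Φ x‖ ≤ C := by
    obtain ⟨C, hC⟩ := Φ.decay 0 0
    exact ⟨C, hC.1.le, fun x => by simpa using hC.2 x⟩
  have hc : Continuous fun T : En n × En n => Φ (WithLp.toLp 2 T) :=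
    Φ.continuous.comp (WithLp.prod_continuous_toLp 2 _ _)
  have hΨ : Integrable fun T : En n × En n => Φ (WithLp.toLp 2 T) * winR g T :=
    (integrable_winR g).bdd_mul (c := C) hc.aestronglyMeasurable (Eventually.of_forall fun T => hC _)
  rw [integral_mul_integral_translate hb hΨ]
  congr 1 with Z
  congr 1 with T
  ring

/-- Integrating the localised bounds over phase space. -/
lemma lintegral_lintegral_Vk_le (g v : 𝓢(En n, ℂ)) {A : ℝ} (hA : 0 ≤ A) (M : ℕ) {w : En n → ℝ}
    (hwc : Continuous w) (hw : Temperate A M w) :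
    ∫⁻ Z : En n × En n, ∫⁻ P : Ph n,
      ENNReal.ofReal (((1 + ‖P‖) ^ (M + 2 * n + 1))⁻¹) * (ENNReal.ofReal (w Z.2) *
        (‖Vk g v 1 Z.1 (Z.2 - (2 * π) • P.fst)‖ₑ * ‖Vk g v 1 (Z.1 - (2 * π) • P.snd) Z.2‖ₑ)) ≤
      ENNReal.ofReal (A * 7 ^ M + 1) * (∫⁻ P : Ph n, ENNReal.ofReal (((1 + ‖P‖) ^ (2 * n + 1))⁻¹)) *
        ∫⁻ ξ, ENNReal.ofReal (w ξ) * ∫⁻ x, ‖Vk g v 1 x ξ‖ₑ ^ 2 := by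
  have hV := continuous_Vk g v 1
  obtain ⟨F, hF⟩ : ∃ F : En n × En n → ℝ≥0∞, F = fun q => ‖Vk g v 1 q.1 q.2‖ₑ := ⟨_, rfl⟩
  have hFc : Continuous F := hF ▸ hV.enorm
  have hF' : ∀ x ξ, ‖Vk g v 1 x ξ‖ₑ = F (x, ξ) := fun x ξ => by rw [hF]
  simp only [hF']
  have hFm : Measurable F := hFc.measurable
  have hwm : Measurable fun ξ => ENNReal.ofReal (w ξ) := hwc.measurable.ennreal_ofReal
  have hc := WithLp.prod_continuous_ofLp 2 (En n) (En n)
  have hfst : Measurable fun P : Ph n => P.fst := (continuous_fst.comp hc).measurable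
  have hsnd : Measurable fun P : Ph n => P.snd := (continuous_snd.comp hc).measurable
  rw [lintegral_lintegral_swap (by
    refine Measurable.aemeasurable ?_
    simp only [Function.uncurry_def]
    fun_prop)]
  have hk : ∀ P : Ph n, ∫⁻ Z : En n × En n,
      ENNReal.ofReal (((1 + ‖P‖) ^ (M + 2 * n + 1))⁻¹) * (ENNReal.ofReal (w Z.2) *
        (F (Z.1, Z.2 - (2 * π) • P.fst) * F (Z.1 - (2 * π) • P.snd, Z.2))) ≤
      ENNReal.ofReal (A * 7 ^ M + 1) * ENNReal.ofReal (((1 + ‖P‖) ^ (2 * n + 1))⁻¹) *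
        ∫⁻ ξ, ENNReal.ofReal (w ξ) * ∫⁻ x, F (x, ξ) ^ 2 := by
    intro P
    have h1 := lintegral_shifted_mul_le hFm hwm (B := ENNReal.ofReal (A * (1 + ‖(2 * π) • P.fst‖) ^ M))
      ((2 * π) • P.fst) ((2 * π) • P.snd) (fun ξ => by
        rw [← ENNReal.ofReal_mul (by positivity)]
        exact ENNReal.ofReal_le_ofReal (hw.2 ξ _))
    rw [lintegral_const_mul' _ _ ENNReal.ofReal_ne_top]
    refine (mul_le_mul_right h1 _).trans ?_
    rw [← mul_assoc]
    refine mul_le_mul_left ?_ _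
    rw [← ENNReal.ofReal_one, ← ENNReal.ofReal_add (by positivity) zero_le_one,
      ← ENNReal.ofReal_mul (by positivity), ← ENNReal.ofReal_mul (by positivity)]
    refine ENNReal.ofReal_le_ofReal ?_
    have h2 : 1 + ‖(2 * π) • P.fst‖ ≤ 7 * (1 + ‖P‖) := by
      rw [norm_smul, Real.norm_of_nonneg (by positivity)]
      have := norm_phL_fst_le P
      change ‖P.fst‖ ≤ _ at this
      nlinarith [Real.pi_lt_d2, Real.pi_pos, norm_nonneg P.fst, norm_nonneg P]
    have h3 : (1 : ℝ) ≤ (1 + ‖P‖) ^ M := one_le_pow₀ (by linarith [norm_nonneg P])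
    have h4 : A * (1 + ‖(2 * π) • P.fst‖) ^ M + 1 ≤ (A * 7 ^ M + 1) * (1 + ‖P‖) ^ M := by
      have : A * (1 + ‖(2 * π) • P.fst‖) ^ M ≤ A * (7 * (1 + ‖P‖)) ^ M := by gcongr
      rw [mul_pow] at this
      nlinarith
    have hp : (0 : ℝ) < 1 + ‖P‖ := by positivity
    rw [inv_mul_eq_div, ← div_eq_mul_inv, div_le_div_iff₀ (by positivity) (by positivity)]
    calc _ ≤ (A * 7 ^ M + 1) * (1 + ‖P‖) ^ M * (1 + ‖P‖) ^ (2 * n + 1) := by gcongr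
      _ = _ := by ring
  refine (lintegral_mono hk).trans_eq ?_
  rw [lintegral_mul_const _ (by fun_prop), lintegral_const_mul _ (by fun_prop)]

/-- A symbol with symbol bounds in all coordinate directions gives a form bounded by the
weighted norm, with a constant depending only on the temperateness constants. -/
theorem symbol_form_bound (n : ℕ) {A : ℝ} (hA : 0 ≤ A) (M : ℕ) :
    ∃ (k : ℕ) (C : ℝ≥0∞), C ≠ ⊤ ∧ ∀ (b : En n × En n → ℂ) (w0 w1 w : En n → ℝ), ContDiff ℝ ∞ b →
      Temperate A M w0 → Temperate A M w1 → Temperate A M w → Continuous w →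
      (∀ ξ, w0 ξ * w1 ξ ≤ w ξ ^ 2) → (∀ X, ‖b X‖ ≤ w0 X.2) → (∀ X, ‖b X‖ ≤ w1 X.2) →
      PureBound k b w1 → ∀ u : 𝓢(En n, ℂ),
      ‖∫ X, b X * Rk u (ftS u) X‖ₑ ≤ C * ∫⁻ ξ, ENNReal.ofReal (w ξ) * ‖ftS u ξ‖ₑ ^ 2 := by
  obtain ⟨g, hg⟩ := exists_isWindow n
  obtain ⟨Φ, hΦ, hne⟩ := exists_companion g hg
  obtain ⟨C1, hC1, h1⟩ := fourier_localised_decay Φ hA M (M + 2 * n)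
  obtain ⟨C2, hC2, h2⟩ := lintegral_weight_Vk_le g hA M one_pos
  set c := ∫ T : En n × En n, Φ (WithLp.toLp 2 T) * winR g T with hc
  have hc0 : ‖c‖ₑ ≠ 0 := by simpa using hne
  refine ⟨2 * (M + 2 * n) + 2, ‖c‖ₑ⁻¹ * (ENNReal.ofReal (cn n * C1) *
    (ENNReal.ofReal (A * 7 ^ M + 1) * (∫⁻ P : Ph n, ENNReal.ofReal (((1 + ‖P‖) ^ (2 * n + 1))⁻¹)) *
      C2)), ?_, ?_⟩
  · exact ENNReal.mul_ne_top (ENNReal.inv_ne_top.2 hc0) (ENNReal.mul_ne_top ENNReal.ofReal_ne_top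
      (ENNReal.mul_ne_top (ENNReal.mul_ne_top ENNReal.ofReal_ne_top (lintegral_decay_ne_top n)) hC2))
  intro b w0 w1 w hb hw0 hw1 hw hwc hww hb0 hb1 hpb u
  have hint : Integrable fun X => b X * Rk u (ftS u) X := by
    refine integrable_mul_Rk u (ftS u) hb.continuous (A := A * w0 0) (M := M) fun X => ?_
    have := hw0.2 0 X.2
    rw [zero_add] at this
    exact (hb0 X).trans (this.trans_eq (by ring))
  have key : ‖c‖ₑ * ‖∫ X, b X * Rk u (ftS u) X‖ₑ ≤ ENNReal.ofReal (cn n * C1) *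
    (ENNReal.ofReal (A * 7 ^ M + 1) * (∫⁻ P : Ph n, ENNReal.ofReal (((1 + ‖P‖) ^ (2 * n + 1))⁻¹)) *
      C2) * ∫⁻ ξ, ENNReal.ofReal (w ξ) * ‖ftS u ξ‖ₑ ^ 2 := by
    rw [← enorm_mul, hc, integral_companion_mul g u Φ hint]
    refine (enorm_integral_le_lintegral_enorm _).trans ?_
    have hcn := (cn_pos (n := n)).le
    have hJ : ∀ Z : En n × En n, ‖∫ T : En n × En n, (b (Z + T) * Φ (WithLp.toLp 2 T)) *
        (winR g T * Rk u (ftS u) (Z + T))‖ₑ ≤ ENNReal.ofReal (cn n * C1) * ∫⁻ P : Ph n,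
      ENNReal.ofReal (((1 + ‖P‖) ^ (M + 2 * n + 1))⁻¹) * (ENNReal.ofReal (w Z.2) *
        (‖Vk g (ftS u) 1 Z.1 (Z.2 - (2 * π) • P.fst)‖ₑ *
          ‖Vk g (ftS u) 1 (Z.1 - (2 * π) • P.snd) Z.2‖ₑ)) := by
      intro Z
      have hs : HasCompactSupport fun T : Ph n => b (Z + phL n T) * Φ T := hΦ.mul_left
      have hd : ContDiff ℝ ∞ fun T : Ph n => b (Z + phL n T) * Φ T :=
        (hb.comp (contDiff_const.add (phL n).contDiff)).mul (Φ.smooth ⊤)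
      have h3 := enorm_integral_localised_le g u hg (hs.toSchwartzMap hd) Z
        (h := fun P => C1 * w Z.2 * ((1 + ‖P‖) ^ (M + 2 * n + 1))⁻¹) (fun P => by
          have := h1 b w0 w1 w hb hw0 hw1 hw.1 hww hb0 hpb hb1 Z (hs.toSchwartzMap hd)
            (fun T => rfl) P
          rw [norm_neg, ← div_eq_mul_inv, le_div_iff₀ (by positivity), mul_comm]
          exact this)
      refine h3.trans_eq ?_
      rw [← lintegral_const_mul' _ _ ENNReal.ofReal_ne_top]
      refine lintegral_congr fun P => ?_
      have hwZ := hw.1 Z.2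
      simp only [← mul_assoc]
      rw [← ENNReal.ofReal_mul (by positivity), ← ENNReal.ofReal_mul (by positivity)]
      congr 3
      ring
    refine (lintegral_mono hJ).trans ?_
    rw [lintegral_const_mul' _ _ ENNReal.ofReal_ne_top, mul_assoc, mul_assoc _ C2]
    refine mul_le_mul_right ((lintegral_lintegral_Vk_le g (ftS u) hA M hwc hw).trans ?_) _
    exact mul_le_mul_right (h2 _ _ hwc hw) _
  rw [mul_assoc _ (_ * _)]
  refine le_trans (le_of_eq ?_) (mul_le_mul_right key _)
  rw [← mul_assoc, ENNReal.inv_mul_cancel hc0 enorm_ne_top, one_mul]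

end

noncomputable section

open scoped FourierTransform ContDiff ComplexConjugate SchwartzMap

variable {n : ℕ}

lemma mpd_zero {F : Type*} [NormedAddCommGroup F] [NormedSpace ℝ F] (f : En n → F) :
    mpd 0 f = f := by
  unfold mpd
  induction List.finRange n with
  | nil => rfl
  | cons i l ih => simp

lemma mpd_single {F : Type*} [NormedAddCommGroup F] [NormedSpace ℝ F] (j : Fin n) (k : ℕ)
    (f : En n → F) : mpd (Pi.single j k) f = (pd j)^[k] f := by
  have key : ∀ l : List (Fin n), l.Nodup →
      l.foldr (fun i g => (pd i)^[(Pi.single j k : Fin n → ℕ) i] g) f =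
        if j ∈ l then (pd j)^[k] f else f := by
    intro l hl
    induction l with
    | nil => simp
    | cons i l ih =>
      rw [List.nodup_cons] at hl
      rw [List.foldr_cons, ih hl.2]
      by_cases hij : j = i
      · subst hij
        simp [hl.1]
      · have : i ≠ j := fun h => hij h.symm
        simp [hij, this]
  rw [mpd, key _ (List.nodup_finRange n), if_pos (List.mem_finRange j)]

lemma EuclideanSpace.opNorm_le_sum {F : Type*} [NormedAddCommGroup F] [NormedSpace ℝ F]
    (T : En n →L[ℝ] F) : ‖T‖ ≤ ∑ i, ‖T (EuclideanSpace.single i 1)‖ := by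
  refine T.opNorm_le_bound (Finset.sum_nonneg fun _ _ => norm_nonneg _) fun x => ?_
  have hx : x = ∑ i, x i • EuclideanSpace.single i (1 : ℝ) := by
    ext j
    simp [Finset.sum_apply, Pi.single_apply]
  conv_lhs => rw [hx, map_sum]
  refine (norm_sum_le _ _).trans ?_
  rw [Finset.sum_mul]
  refine Finset.sum_le_sum fun i _ => ?_
  rw [map_smul, norm_smul, mul_comm]
  gcongr
  exact PiLp.norm_apply_le x i

lemma rpow_le_of_comparable {x y K : ℝ} (hx : 0 < x) (hy : 0 < y) (hK : 1 ≤ K)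
    (h1 : x ≤ K * y) (h2 : y ≤ K * x) (r : ℝ) : x ^ r ≤ K ^ |r| * y ^ r := by
  have hK0 : 0 < K := by linarith
  rcases le_total 0 r with hr | hr
  · rw [abs_of_nonneg hr, ← Real.mul_rpow hK0.le hy.le]
    exact Real.rpow_le_rpow hx.le h1 hr
  · rw [abs_of_nonpos hr, Real.rpow_neg hK0.le, ← Real.inv_rpow hK0.le,
      ← Real.mul_rpow (by positivity) hy.le]
    refine Real.rpow_le_rpow_of_nonpos (by positivity) ?_ hr
    rwa [inv_mul_le_iff₀ hK0]

variable {Λ : En n → ℝ} {μ₀ μ₁ μ : ℝ}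

lemma IsWeight.mu_pos (hw : IsWeight n Λ μ₀ μ₁ μ) : 0 < μ :=
  hw.hμ₀.trans_le (hw.hμ₀₁.trans hw.hμ₁)

lemma IsWeight.exists_pos_le (hw : IsWeight n Λ μ₀ μ₁ μ) : ∃ c > 0, ∀ ξ, c ≤ Λ ξ := by
  obtain ⟨C₀, C₁, h0, -, h⟩ := hw.growth
  refine ⟨C₀, h0, fun ξ => le_trans ?_ (h ξ).1⟩
  have : 1 ≤ (1 + ‖ξ‖) ^ μ₀ := Real.one_le_rpow (by linarith [norm_nonneg ξ]) hw.hμ₀.le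
  nlinarith

lemma IsWeight.continuous_rpow (hw : IsWeight n Λ μ₀ μ₁ μ) (a : ℝ) :
    Continuous fun ξ => Λ ξ ^ a :=
  hw.smooth.continuous.rpow_const fun ξ => Or.inl (hw.pos ξ).ne'

/-- The `μ`-th root of the weight is Lipschitz. -/
lemma IsWeight.exists_lipschitz (hw : IsWeight n Λ μ₀ μ₁ μ) :
    ∃ L, 0 ≤ L ∧ ∀ ξ t, |Λ (ξ + t) ^ μ⁻¹ - Λ ξ ^ μ⁻¹| ≤ L * ‖t‖ := by
  have hμ := hw.mu_pos
  have hb : ∀ i, ∃ C > 0, ∀ ξ, |pd i Λ ξ| ≤ C * Λ ξ ^ (1 - μ⁻¹) := by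
    intro i
    obtain ⟨C, hC, h⟩ := hw.deriv_bound (Pi.single i 1) 0 (by simp)
    refine ⟨C, hC, fun ξ => ?_⟩
    have := h ξ
    rw [add_zero, mpd_single] at this
    have hs : ∑ j, (((Pi.single i 1 : Fin n → ℕ) j : ℕ) : ℝ) = 1 := by
      rw [← Nat.cast_sum, Finset.sum_pi_single']
      simp
    simpa [hs] using this
  choose C hC hCb using hb
  have hd : Differentiable ℝ Λ := hw.smooth.differentiable (by simp)
  have hdl : ∀ ξ, HasFDerivAt (fun ξ => Λ ξ ^ μ⁻¹)
      ((μ⁻¹ * Λ ξ ^ (μ⁻¹ - 1)) • fderiv ℝ Λ ξ) ξ := fun ξ =>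
    (hd ξ).hasFDerivAt.rpow_const (Or.inl (hw.pos ξ).ne')
  refine ⟨∑ i, μ⁻¹ * C i, Finset.sum_nonneg fun i _ => by have := hC i; positivity, fun ξ t => ?_⟩
  have := Convex.norm_image_sub_le_of_norm_hasFDerivWithin_le (f := fun ξ => Λ ξ ^ μ⁻¹)
    (s := Set.univ) (C := ∑ i, μ⁻¹ * C i) (x := ξ) (y := ξ + t)
    (fun x _ => (hdl x).hasFDerivWithinAt) (fun x _ => ?_) convex_univ trivial trivial
  · simpa using this
  refine (EuclideanSpace.opNorm_le_sum _).trans (Finset.sum_le_sum fun i _ => ?_)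
  have hx := hw.pos x
  have h1 := hCb i x
  have h2 : Λ x ^ (μ⁻¹ - 1) * Λ x ^ (1 - μ⁻¹) = 1 := by
    rw [← Real.rpow_add hx]; simp
  rw [smul_apply, norm_smul, Real.norm_of_nonneg (by positivity),
    Real.norm_eq_abs]
  change _ * |pd i Λ x| ≤ _
  calc _ ≤ μ⁻¹ * Λ x ^ (μ⁻¹ - 1) * (C i * Λ x ^ (1 - μ⁻¹)) := by gcongr
    _ = μ⁻¹ * C i * (Λ x ^ (μ⁻¹ - 1) * Λ x ^ (1 - μ⁻¹)) := by ring
    _ = _ := by rw [h2, mul_one]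

lemma IsWeight.rpow_root (hw : IsWeight n Λ μ₀ μ₁ μ) (a : ℝ) (ξ : En n) :
    Λ ξ ^ a = (Λ ξ ^ μ⁻¹) ^ (μ * a) := by
  rw [← Real.rpow_mul (hw.pos ξ).le, ← mul_assoc, inv_mul_cancel₀ hw.mu_pos.ne', one_mul]

lemma one_add_rpow_le_pow_ceil (r : ℝ) {s : ℝ} (hs : 0 ≤ s) : (1 + s) ^ r ≤ (1 + s) ^ ⌈r⌉₊ := by
  rw [← Real.rpow_natCast]
  exact Real.rpow_le_rpow_of_exponent_le (by linarith) (Nat.le_ceil r)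

lemma Temperate.mono {A B : ℝ} {M N : ℕ} {w : En n → ℝ} (hw : Temperate A M w) (hA : 0 ≤ A)
    (hAB : A ≤ B) (hMN : M ≤ N) : Temperate B N w := by
  refine ⟨hw.1, fun ξ t => (hw.2 ξ t).trans ?_⟩
  have := hw.1 ξ
  have h1 : (1 + ‖t‖) ^ M ≤ (1 + ‖t‖) ^ N :=
    pow_le_pow_right₀ (by linarith [norm_nonneg t]) hMN
  have h2 : 0 ≤ B := hA.trans hAB
  gcongr

lemma Temperate.add {A : ℝ} {M : ℕ} {w w' : En n → ℝ} (hw : Temperate A M w)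
    (hw' : Temperate A M w') : Temperate A M (fun ξ => w ξ + w' ξ) :=
  ⟨fun ξ => add_nonneg (hw.1 ξ) (hw'.1 ξ), fun ξ t => by
    rw [mul_add]; exact add_le_add (hw.2 ξ t) (hw'.2 ξ t)⟩

lemma Temperate.const_mul {A : ℝ} {M : ℕ} {w : En n → ℝ} (hw : Temperate A M w) {c : ℝ}
    (hc : 0 ≤ c) : Temperate A M (fun ξ => c * w ξ) :=
  ⟨fun ξ => mul_nonneg hc (hw.1 ξ), fun ξ t => by
    rw [mul_left_comm]; exact mul_le_mul_of_nonneg_left (hw.2 ξ t) hc⟩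

/-- Real powers of the weight are temperate. -/
lemma IsWeight.exists_temperate (hw : IsWeight n Λ μ₀ μ₁ μ) (a : ℝ) :
    ∃ (A : ℝ) (M : ℕ), 1 ≤ A ∧ Temperate A M (fun ξ => Λ ξ ^ a) := by
  obtain ⟨L, hL, hlip⟩ := hw.exists_lipschitz
  obtain ⟨c, hc, hcΛ⟩ := hw.exists_pos_le
  have hμ := hw.mu_pos
  have hl0 : 0 < c ^ μ⁻¹ := by positivity
  have hle : ∀ ξ, c ^ μ⁻¹ ≤ Λ ξ ^ μ⁻¹ := fun ξ =>
    Real.rpow_le_rpow hc.le (hcΛ ξ) (by positivity)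
  set B := 1 + L / c ^ μ⁻¹ with hB
  have hB1 : 1 ≤ B := by have : 0 ≤ L / c ^ μ⁻¹ := by positivity
                         linarith
  have hB0 : 0 < B := by linarith
  have hLB : L ≤ B * c ^ μ⁻¹ := by
    rw [hB, add_mul, div_mul_cancel₀ _ hl0.ne']; linarith
  have hcmp : ∀ ξ t s : En n, |Λ s ^ μ⁻¹ - Λ ξ ^ μ⁻¹| ≤ L * ‖t‖ →
      Λ s ^ μ⁻¹ ≤ B * (1 + ‖t‖) * Λ ξ ^ μ⁻¹ := by
    intro ξ t s h
    have h1 := (abs_le.1 h).2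
    have h2 := hle ξ
    have h3 := norm_nonneg t
    have h4 : L * ‖t‖ ≤ B * Λ ξ ^ μ⁻¹ * ‖t‖ := by
      gcongr
      exact hLB.trans (by gcongr)
    nlinarith
  refine ⟨B ^ |μ * a|, ⌈|μ * a|⌉₊, Real.one_le_rpow hB1 (abs_nonneg _),
    fun ξ => (Real.rpow_pos_of_pos (hw.pos ξ) a).le, fun ξ t => ?_⟩
  have ht := norm_nonneg t
  simp only [hw.rpow_root a]
  have h1 := Real.rpow_pos_of_pos (hw.pos ξ) μ⁻¹
  have h2 := Real.rpow_pos_of_pos (hw.pos (ξ + t)) μ⁻¹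
  refine (rpow_le_of_comparable h2 h1 (K := B * (1 + ‖t‖)) (by nlinarith)
    (hcmp ξ t _ (hlip ξ t)) (hcmp (ξ + t) t _ (by rw [abs_sub_comm]; exact hlip ξ t)) _).trans ?_
  rw [Real.mul_rpow hB0.le (by positivity)]
  gcongr
  exact one_add_rpow_le_pow_ceil _ ht

/-- Slow variation of the weight, up to a gain of `ρ` in the order. -/
lemma IsWeight.exists_slow (hw : IsWeight n Λ μ₀ μ₁ μ) (a : ℝ) {ρ : ℝ} (hρ : 0 < ρ) :
    ∃ (C : ℝ) (M : ℕ), 1 ≤ C ∧ ∀ ξ t,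
      Λ (ξ + t) ^ a ≤ C * Λ ξ ^ a + C * (1 + ‖t‖) ^ M * Λ ξ ^ (a - ρ) ∧
      Λ ξ ^ a ≤ C * Λ (ξ + t) ^ a + C * (1 + ‖t‖) ^ M * Λ ξ ^ (a - ρ) := by
  obtain ⟨L, hL, hlip⟩ := hw.exists_lipschitz
  obtain ⟨A, M, hA, hT⟩ := hw.exists_temperate a
  have hμ := hw.mu_pos
  set D := (2 * L + 1) ^ (μ * ρ) with hD
  have hD1 : 1 ≤ D := Real.one_le_rpow (by linarith) (by positivity)
  set E := (2 : ℝ) ^ |μ * a| with hE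
  have hE1 : 1 ≤ E := Real.one_le_rpow (by norm_num) (abs_nonneg _)
  have hAD : 1 ≤ A * D := one_le_mul_of_one_le_of_one_le hA hD1
  refine ⟨E + A * D, M + ⌈μ * ρ⌉₊, by linarith, fun ξ t => ?_⟩
  have ht := norm_nonneg t
  have hx := hw.pos ξ
  have hy := hw.pos (ξ + t)
  have p1 := Real.rpow_pos_of_pos hx a
  have p2 := Real.rpow_pos_of_pos hy a
  have p3 := Real.rpow_pos_of_pos hx (a - ρ)
  have hpow : (1 : ℝ) ≤ (1 + ‖t‖) ^ M := one_le_pow₀ (by linarith)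
  have hpow' : (1 : ℝ) ≤ (1 + ‖t‖) ^ (M + ⌈μ * ρ⌉₊) := one_le_pow₀ (by linarith)
  have hlx := Real.rpow_pos_of_pos hx μ⁻¹
  have hly := Real.rpow_pos_of_pos hy μ⁻¹
  have hl := abs_le.1 (hlip ξ t)
  by_cases hc : 2 * L * ‖t‖ ≤ Λ ξ ^ μ⁻¹
  · have hr : 0 ≤ (E + A * D) * (1 + ‖t‖) ^ (M + ⌈μ * ρ⌉₊) * Λ ξ ^ (a - ρ) := by positivity
    have c1 : Λ (ξ + t) ^ a ≤ E * Λ ξ ^ a := by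
      rw [hw.rpow_root a, hw.rpow_root a ξ]
      exact rpow_le_of_comparable hly hlx (by norm_num) (by linarith) (by linarith) _
    have c2 : Λ ξ ^ a ≤ E * Λ (ξ + t) ^ a := by
      rw [hw.rpow_root a, hw.rpow_root a (ξ + t)]
      exact rpow_le_of_comparable hlx hly (by norm_num) (by linarith) (by linarith) _
    constructor <;> nlinarith
  · push Not at hc
    have hgain : Λ ξ ^ a ≤ D * (1 + ‖t‖) ^ ⌈μ * ρ⌉₊ * Λ ξ ^ (a - ρ) := by
      have e1 : Λ ξ ^ ρ ≤ D * (1 + ‖t‖) ^ ⌈μ * ρ⌉₊ := by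
        rw [hw.rpow_root ρ]
        calc (Λ ξ ^ μ⁻¹) ^ (μ * ρ) ≤ ((2 * L + 1) * (1 + ‖t‖)) ^ (μ * ρ) :=
              Real.rpow_le_rpow hlx.le (by nlinarith) (by positivity)
          _ = D * (1 + ‖t‖) ^ (μ * ρ) := Real.mul_rpow (by positivity) (by positivity)
          _ ≤ _ := by gcongr; exact one_add_rpow_le_pow_ceil _ ht
      calc Λ ξ ^ a = Λ ξ ^ ρ * Λ ξ ^ (a - ρ) := by rw [← Real.rpow_add hx]; simp
        _ ≤ _ := by gcongr
    have q : Λ ξ ^ a ≤ D * ((1 + ‖t‖) ^ (M + ⌈μ * ρ⌉₊) * Λ ξ ^ (a - ρ)) := by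
      refine hgain.trans ?_
      rw [pow_add, mul_assoc]
      have : 0 < (1 + ‖t‖) ^ ⌈μ * ρ⌉₊ * Λ ξ ^ (a - ρ) := by positivity
      have h5 : (1 + ‖t‖) ^ ⌈μ * ρ⌉₊ * Λ ξ ^ (a - ρ) ≤
        (1 + ‖t‖) ^ M * ((1 + ‖t‖) ^ ⌈μ * ρ⌉₊ * Λ ξ ^ (a - ρ)) := le_mul_of_one_le_left this.le hpow
      rw [mul_assoc ((1 + ‖t‖) ^ M)]
      gcongr
    have r1 : Λ (ξ + t) ^ a ≤ A * D * ((1 + ‖t‖) ^ (M + ⌈μ * ρ⌉₊) * Λ ξ ^ (a - ρ)) := by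
      calc Λ (ξ + t) ^ a ≤ A * (1 + ‖t‖) ^ M * Λ ξ ^ a := hT.2 ξ t
        _ ≤ A * (1 + ‖t‖) ^ M * (D * (1 + ‖t‖) ^ ⌈μ * ρ⌉₊ * Λ ξ ^ (a - ρ)) := by gcongr
        _ = _ := by ring
    have hX : 0 < (1 + ‖t‖) ^ (M + ⌈μ * ρ⌉₊) * Λ ξ ^ (a - ρ) := by positivity
    have hEA : 0 < E + A * D := by linarith
    have s1 := mul_pos hEA p1
    have s2 := mul_pos hEA p2
    rw [mul_assoc (E + A * D)]
    generalize (1 + ‖t‖) ^ (M + ⌈μ * ρ⌉₊) * Λ ξ ^ (a - ρ) = X at *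
    have hEX : 0 < E * X := by positivity
    have hDX : D * X ≤ A * D * X := by nlinarith [mul_pos (show 0 < D by linarith) hX]
    constructor <;> nlinarith

end

noncomputable section

open scoped FourierTransform ContDiff ComplexConjugate SchwartzMap

variable {n : ℕ} {Λ : En n → ℝ} {μ₀ μ₁ μ ρ a : ℝ} {σ : En n → En n → ℂ}

lemma MClass.sClass (hσ : MClass Λ ρ a σ) : SClass Λ ρ a σ := by
  have h := hσ 0 (by simp)
  simpa [mixpd, mpd_zero] using h

lemma mixpd_single_left (hσ : ContDiff ℝ ∞ (fun q : En n × En n => σ q.1 q.2)) (j : Fin n) (k : ℕ)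
    (X : En n × En n) : mixpd (Pi.single j k) 0 σ X.1 X.2 =
      (dirD (EuclideanSpace.single j 1, 0))^[k] (fun q : En n × En n => σ q.1 q.2) X := by
  have h := dirD_iterate_comp_affine (ContinuousLinearMap.inl ℝ (En n) (En n)) (0, X.2)
    (EuclideanSpace.single j 1) k _ hσ X.1
  simp only [ContinuousLinearMap.inl_apply, Prod.mk_add_mk, zero_add, add_zero] at h
  simp only [mixpd, mpd_zero, mpd_single]
  exact h

lemma mixpd_single_right (hσ : ContDiff ℝ ∞ (fun q : En n × En n => σ q.1 q.2)) (j : Fin n) (k : ℕ)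
    (X : En n × En n) : mixpd 0 (Pi.single j k) σ X.1 X.2 =
      (dirD (0, EuclideanSpace.single j 1))^[k] (fun q : En n × En n => σ q.1 q.2) X := by
  have h := dirD_iterate_comp_affine (ContinuousLinearMap.inr ℝ (En n) (En n)) (X.1, 0)
    (EuclideanSpace.single j 1) k _ hσ X.2
  simp only [ContinuousLinearMap.inr_apply, Prod.mk_add_mk, zero_add, add_zero] at h
  simp only [mixpd, mpd_zero, mpd_single]
  exact h

lemma sum_single_cast (j : Fin n) (k : ℕ) :
    ∑ i, (((Pi.single j k : Fin n → ℕ) i : ℕ) : ℝ) = k := by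
  rw [← Nat.cast_sum, Finset.sum_pi_single']
  simp

/-- Lowering the order of a power of the weight. -/
lemma IsWeight.exists_rpow_sub_le (hw : IsWeight n Λ μ₀ μ₁ μ) (a : ℝ) {r : ℝ} (hr : 0 ≤ r) :
    ∃ C > 0, ∀ ξ, Λ ξ ^ (a - r) ≤ C * Λ ξ ^ a := by
  obtain ⟨c, hc, hcΛ⟩ := hw.exists_pos_le
  refine ⟨c ^ (-r), by positivity, fun ξ => ?_⟩
  have := hw.pos ξ
  rw [sub_eq_neg_add, Real.rpow_add this]
  gcongr ?_ * _
  exact Real.rpow_le_rpow_of_nonpos hc (hcΛ ξ) (by linarith)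

lemma SClass.exists_pureBound (hw : IsWeight n Λ μ₀ μ₁ μ) (hρ : 0 < ρ) (hσ : SClass Λ ρ a σ)
    (k : ℕ) : ∃ C > 0, (∀ x ξ, ‖σ x ξ‖ ≤ C * Λ ξ ^ a) ∧
      PureBound k (fun q : En n × En n => σ q.1 q.2) (fun ξ => C * Λ ξ ^ a) := by
  have h : ∀ (j : Fin n ⊕ Fin n) (i : ℕ), ∃ C > 0, ∀ X : En n × En n,
      ‖(dirD (phL n (phBasis n j)))^[i] (fun q : En n × En n => σ q.1 q.2) X‖ ≤
        C * Λ X.2 ^ a := by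
    rintro (j | j) i
    · obtain ⟨C, hC, h⟩ := hσ.2 (Pi.single j i) 0
      refine ⟨C, hC, fun X => ?_⟩
      rw [phL_phBasis_inl, ← mixpd_single_left hσ.1]
      simpa using h X.1 X.2
    · obtain ⟨C, hC, h⟩ := hσ.2 0 (Pi.single j i)
      obtain ⟨D, hD, h'⟩ := hw.exists_rpow_sub_le a (r := ρ * i) (by positivity)
      refine ⟨C * D, by positivity, fun X => ?_⟩
      rw [phL_phBasis_inr, ← mixpd_single_right hσ.1]
      refine (h X.1 X.2).trans ?_
      rw [sum_single_cast, mul_assoc]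
      gcongr
      exact h' _
  choose C hC hCb using h
  obtain ⟨C0, hC0, hb0⟩ := hσ.2 0 0
  have hsum : ∀ j, 0 ≤ ∑ i ∈ Finset.range (k + 1), C j i := fun j =>
    Finset.sum_nonneg fun i _ => (hC j i).le
  have hsum' : 0 ≤ ∑ j, ∑ i ∈ Finset.range (k + 1), C j i := Finset.sum_nonneg fun j _ => hsum j
  refine ⟨C0 + ∑ j, ∑ i ∈ Finset.range (k + 1), C j i, by positivity, fun x ξ => ?_,
    fun j i hi X => ?_⟩
  · have := Real.rpow_pos_of_pos (hw.pos ξ) a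
    have h1 := hb0 x ξ
    simp only [mixpd, mpd_zero, Pi.zero_apply, Nat.cast_zero, Finset.sum_const_zero, mul_zero,
      sub_zero] at h1
    exact h1.trans (mul_le_mul_of_nonneg_right (by linarith) this.le)
  · have := Real.rpow_pos_of_pos (hw.pos X.2) a
    refine (hCb j i X).trans (mul_le_mul_of_nonneg_right ?_ this.le)
    have h1 : C j i ≤ ∑ i ∈ Finset.range (k + 1), C j i :=
      Finset.single_le_sum (f := fun i => C j i) (fun i _ => (hC j i).le)
        (Finset.mem_range.2 (by omega))
    have h2 := Finset.single_le_sum (f := fun j => ∑ i ∈ Finset.range (k + 1), C j i)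
      (fun j _ => hsum j) (Finset.mem_univ j)
    linarith

/-- Differences of a symbol in the space variable. -/
lemma SClass.exists_norm_sub_left_le (hw : IsWeight n Λ μ₀ μ₁ μ) (hσ : SClass Λ ρ a σ) :
    ∃ C > 0, ∀ x y ξ, ‖σ x ξ - σ (x - y) ξ‖ ≤ C * ‖y‖ * Λ ξ ^ a := by
  choose C hC h using fun j : Fin n => hσ.2 (Pi.single j 1) 0
  have hS : 0 ≤ ∑ j, C j := Finset.sum_nonneg fun j _ => (hC j).le
  refine ⟨1 + ∑ j, C j, by linarith, fun x y ξ => ?_⟩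
  have hd : Differentiable ℝ (fun x => σ x ξ) :=
    (hσ.1.comp (contDiff_prodMk_left ξ)).differentiable (by simp)
  have hb : ∀ x, ‖fderiv ℝ (fun x => σ x ξ) x‖ ≤ (∑ j, C j) * Λ ξ ^ a := by
    intro x
    refine (EuclideanSpace.opNorm_le_sum _).trans ?_
    rw [Finset.sum_mul]
    refine Finset.sum_le_sum fun j _ => ?_
    have := h j x ξ
    simpa [mixpd, mpd_zero, mpd_single, pd] using this
  have := Convex.norm_image_sub_le_of_norm_fderiv_le (f := fun x => σ x ξ) (s := Set.univ)
    (fun x _ => hd x) (fun x _ => hb x) convex_univ (Set.mem_univ (x - y)) (Set.mem_univ x)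
  have hΛ := Real.rpow_pos_of_pos (hw.pos ξ) a
  rw [sub_sub_cancel] at this
  refine this.trans ?_
  nlinarith [mul_nonneg (norm_nonneg y) hΛ.le]

/-- Differences of a symbol in the frequency variable. -/
lemma SClass.exists_norm_sub_right_le (hw : IsWeight n Λ μ₀ μ₁ μ) (hσ : SClass Λ ρ a σ) :
    ∃ C > 0, ∃ M : ℕ, ∀ x ξ η, ‖σ x ξ - σ x (ξ - η)‖ ≤ C * (1 + ‖η‖) ^ M * Λ ξ ^ (a - ρ) := by
  choose C hC h using fun j : Fin n => hσ.2 0 (Pi.single j 1)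
  have hS : 0 ≤ ∑ j, C j := Finset.sum_nonneg fun j _ => (hC j).le
  obtain ⟨A, M, hA, hT⟩ := hw.exists_temperate (a - ρ)
  refine ⟨1 + (∑ j, C j) * A, by positivity, M + 1, fun x ξ η => ?_⟩
  have hd : Differentiable ℝ (fun ξ => σ x ξ) :=
    (hσ.1.comp (contDiff_prodMk_right x)).differentiable (by simp)
  have hη := norm_nonneg η
  have hp := Real.rpow_pos_of_pos (hw.pos ξ) (a - ρ)
  have hb : ∀ ζ ∈ Metric.closedBall ξ ‖η‖, ‖fderiv ℝ (fun ξ => σ x ξ) ζ‖ ≤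
      (∑ j, C j) * (A * (1 + ‖η‖) ^ M * Λ ξ ^ (a - ρ)) := by
    intro ζ hζ
    refine (EuclideanSpace.opNorm_le_sum _).trans ?_
    rw [Finset.sum_mul]
    refine Finset.sum_le_sum fun j _ => ?_
    have h1 := h j x ζ
    rw [sum_single_cast] at h1
    simp only [mixpd, mpd_zero, mpd_single, Function.iterate_one, Nat.cast_one, mul_one] at h1
    refine h1.trans (mul_le_mul_of_nonneg_left ?_ (hC j).le)
    have h2 := hT.2 ξ (ζ - ξ)
    rw [add_sub_cancel] at h2
    refine h2.trans ?_
    have : ‖ζ - ξ‖ ≤ ‖η‖ := by simpa [dist_eq_norm] using hζ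
    gcongr
  have := Convex.norm_image_sub_le_of_norm_fderiv_le (f := fun ξ => σ x ξ) (fun ζ _ => hd ζ) hb
    (convex_closedBall ξ ‖η‖) (x := ξ - η) (y := ξ) (by simp) (by simp)
  rw [sub_sub_cancel] at this
  refine this.trans ?_
  rw [pow_succ]
  have hX : 0 < (1 + ‖η‖) ^ M * Λ ξ ^ (a - ρ) := by positivity
  calc _ = ((∑ j, C j) * A) * ((1 + ‖η‖) ^ M * Λ ξ ^ (a - ρ)) * ‖η‖ := by ring
    _ ≤ (1 + (∑ j, C j) * A) * ((1 + ‖η‖) ^ M * Λ ξ ^ (a - ρ)) * (1 + ‖η‖) := by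
      gcongr <;> linarith
    _ = _ := by ring

/-- The squared weighted norm of order `a / 2`, on the Fourier side. -/
def wnorm (Λ : En n → ℝ) (a : ℝ) (v : 𝓢(En n, ℂ)) : ℝ := ∫ ξ, Λ ξ ^ a * ‖v ξ‖ ^ 2

lemma IsWeight.integrable_wnorm (hw : IsWeight n Λ μ₀ μ₁ μ) (a : ℝ) (v : 𝓢(En n, ℂ)) :
    Integrable fun ξ => Λ ξ ^ a * ‖v ξ‖ ^ 2 := by
  obtain ⟨A, M, hA, hT⟩ := hw.exists_temperate a
  obtain ⟨C, hC0, hC⟩ := v.exists_bound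
  have := hw.continuous_rpow a
  have := v.continuous
  refine ((v.integrable_one_add_norm_pow_mul M).const_mul (A * Λ 0 ^ a * C)).mono'
    (Continuous.aestronglyMeasurable (by fun_prop)) (Eventually.of_forall fun ξ => ?_)
  have h1 := hT.2 0 ξ
  rw [zero_add] at h1
  have h2 := hT.1 ξ
  have h3 := hT.1 0
  simp only at h1 h2 h3
  rw [Real.norm_of_nonneg (by positivity)]
  calc _ ≤ (A * (1 + ‖ξ‖) ^ M * Λ 0 ^ a) * (‖v ξ‖ * C) := by
        rw [sq]; gcongr; exact hC ξ
    _ = _ := by ring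

lemma IsWeight.wnorm_nonneg (hw : IsWeight n Λ μ₀ μ₁ μ) (a : ℝ) (v : 𝓢(En n, ℂ)) :
    0 ≤ wnorm Λ a v :=
  integral_nonneg fun ξ => mul_nonneg (Real.rpow_pos_of_pos (hw.pos ξ) a).le (by positivity)

lemma IsWeight.lintegral_wnorm (hw : IsWeight n Λ μ₀ μ₁ μ) (a : ℝ) (v : 𝓢(En n, ℂ)) :
    ∫⁻ ξ, ENNReal.ofReal (Λ ξ ^ a) * ‖v ξ‖ₑ ^ 2 = ENNReal.ofReal (wnorm Λ a v) := by
  rw [wnorm, ofReal_integral_eq_lintegral_ofReal (hw.integrable_wnorm a v)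
    (Eventually.of_forall fun ξ => mul_nonneg (Real.rpow_pos_of_pos (hw.pos ξ) a).le
      (by positivity))]
  refine lintegral_congr fun ξ => ?_
  rw [ENNReal.ofReal_mul (Real.rpow_pos_of_pos (hw.pos ξ) a).le,
    ENNReal.ofReal_pow (norm_nonneg _), ofReal_norm]

lemma IsWeight.lintegral_wnorm_add (hw : IsWeight n Λ μ₀ μ₁ μ) (a b : ℝ) (v : 𝓢(En n, ℂ))
    {p q : ℝ} (hp : 0 ≤ p) (hq : 0 ≤ q) :
    ∫⁻ ξ, ENNReal.ofReal (p * Λ ξ ^ a + q * Λ ξ ^ b) * ‖v ξ‖ₑ ^ 2 =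
      ENNReal.ofReal (p * wnorm Λ a v + q * wnorm Λ b v) := by
  have ha := hw.wnorm_nonneg a v
  have hb := hw.wnorm_nonneg b v
  have := v.continuous
  have := hw.smooth.continuous
  rw [ENNReal.ofReal_add (by positivity) (by positivity), ENNReal.ofReal_mul hp,
    ENNReal.ofReal_mul hq, ← hw.lintegral_wnorm, ← hw.lintegral_wnorm,
    ← lintegral_const_mul' _ _ ENNReal.ofReal_ne_top,
    ← lintegral_const_mul' _ _ ENNReal.ofReal_ne_top, ← lintegral_add_left (by fun_prop)]
  refine lintegral_congr fun ξ => ?_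
  have h1 := Real.rpow_pos_of_pos (hw.pos ξ) a
  have h2 := Real.rpow_pos_of_pos (hw.pos ξ) b
  rw [ENNReal.ofReal_add (by positivity) (by positivity), ENNReal.ofReal_mul hp,
    ENNReal.ofReal_mul hq]
  ring

lemma IsWeight.exists_common_temperate (hw : IsWeight n Λ μ₀ μ₁ μ) (a b c : ℝ) :
    ∃ (A : ℝ) (M : ℕ), 0 ≤ A ∧ Temperate A M (fun ξ => Λ ξ ^ a) ∧
      Temperate A M (fun ξ => Λ ξ ^ b) ∧ Temperate A M (fun ξ => Λ ξ ^ c) := by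
  obtain ⟨A1, M1, h1, t1⟩ := hw.exists_temperate a
  obtain ⟨A2, M2, h2, t2⟩ := hw.exists_temperate b
  obtain ⟨A3, M3, h3, t3⟩ := hw.exists_temperate c
  exact ⟨A1 + A2 + A3, M1 + M2 + M3, by positivity,
    t1.mono (by linarith) (by linarith) (by omega),
    t2.mono (by linarith) (by linarith) (by omega),
    t3.mono (by linarith) (by linarith) (by omega)⟩

lemma weight_product_le {p q e X Z V : ℝ} (hp : 0 ≤ p) (hq : 1 ≤ q) (he : 0 ≤ e) (hX : 0 ≤ X)
    (hZ : 0 ≤ Z) (hV : 0 ≤ V) (hXZ : X * Z = V ^ 2) (hZV : Z ≤ e * V) :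
    (p * X + q * Z) * (X + q * Z) ≤ ((1 + e) * (√p * X + (1 + p) * q * V)) ^ 2 := by
  have hs : √p ^ 2 = p := Real.sq_sqrt hp
  have hZ2 : Z ^ 2 ≤ (e * V) ^ 2 := pow_le_pow_left₀ hZ hZV 2
  have h1 : 1 ≤ (1 + p) * q := by nlinarith
  have h2 : 0 ≤ √p * X * ((1 + p) * q * V) := by positivity
  have h5 : q ^ 2 ≤ ((1 + p) * q) ^ 2 := by gcongr; nlinarith
  have h6 : (√p * X) ^ 2 = p * X ^ 2 := by rw [mul_pow, hs]
  obtain ⟨r, hr⟩ : ∃ r, r = (1 + p) * q := ⟨_, rfl⟩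
  rw [← hr] at h1 h2 h5 ⊢
  have h3 : r * V ^ 2 ≤ r ^ 2 * V ^ 2 := by gcongr; nlinarith
  have h4 : q ^ 2 * (e * V) ^ 2 ≤ r ^ 2 * (e * V) ^ 2 := by
    gcongr
  calc (p * X + q * Z) * (X + q * Z) = p * X ^ 2 + r * (X * Z) + q ^ 2 * Z ^ 2 := by
        rw [hr]; ring
    _ ≤ p * X ^ 2 + r ^ 2 * V ^ 2 + r ^ 2 * (e * V) ^ 2 := by
        rw [hXZ]
        have : q ^ 2 * Z ^ 2 ≤ q ^ 2 * (e * V) ^ 2 := by gcongr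
        linarith
    _ ≤ (√p * X) ^ 2 + 2 * (√p * X * (r * V)) + (1 + e ^ 2) * (r * V) ^ 2 := by
        rw [h6]; nlinarith
    _ ≤ (1 + 2 * e + e ^ 2) * ((√p * X) ^ 2 + 2 * (√p * X * (r * V)) + (r * V) ^ 2) := by
        have : 0 ≤ 2 * e + e ^ 2 := by positivity
        nlinarith [sq_nonneg (√p * X), sq_nonneg (r * V), mul_nonneg he (sq_nonneg (r * V)),
          mul_nonneg this (sq_nonneg (√p * X)), mul_nonneg this h2]
    _ = _ := by ring

/-- The form of the difference between a symbol and its phase-space translate. -/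
theorem SClass.shift_form_bound (hw : IsWeight n Λ μ₀ μ₁ μ) (hρ : 0 < ρ) (hσ : SClass Λ ρ a σ) :
    ∃ (C : ℝ) (N : ℕ), 0 ≤ C ∧ ∀ (Y : En n × En n) (u : 𝓢(En n, ℂ)),
      ‖∫ X : En n × En n, (σ X.1 X.2 - σ (X.1 - Y.1) (X.2 - Y.2)) * Rk u (ftS u) X‖ ≤
        C * (√‖Y.1‖ * wnorm Λ a (ftS u) +
          (1 + ‖Y.1‖) * (1 + ‖Y.2‖) ^ N * wnorm Λ (a - ρ / 2) (ftS u)) := by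
  obtain ⟨A, M, hA, tX, tZ, tV⟩ := hw.exists_common_temperate a (a - ρ) (a - ρ / 2)
  obtain ⟨k, C, hC, hcv⟩ := symbol_form_bound n hA M
  obtain ⟨D1, hD1, hσ0, hpure⟩ := hσ.exists_pureBound hw hρ k
  obtain ⟨D2, hD2, hleft⟩ := hσ.exists_norm_sub_left_le hw
  obtain ⟨D3, hD3, N3, hright⟩ := hσ.exists_norm_sub_right_le hw
  obtain ⟨D4, N4, hD4, hslow⟩ := hw.exists_slow a hρ
  obtain ⟨e, he, hlow⟩ := hw.exists_rpow_sub_le (a - ρ / 2) (r := ρ / 2) (by positivity)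
  set D := D1 * (1 + D4) + D2 + D3 with hD
  have hD14 : 0 ≤ D1 * (1 + D4) := by positivity
  have hD0 : 0 ≤ D := by positivity
  refine ⟨C.toReal * (D * (1 + e)), N3 + N4, by positivity, fun Y u => ?_⟩
  have hη := norm_nonneg Y.2
  have hp := norm_nonneg Y.1
  have hq1 : (1 : ℝ) ≤ (1 + ‖Y.2‖) ^ (N3 + N4) := one_le_pow₀ (by linarith)
  have hq3 : (1 + ‖Y.2‖) ^ N3 ≤ (1 + ‖Y.2‖) ^ (N3 + N4) :=
    pow_le_pow_right₀ (by linarith) (by omega)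
  have hq4 : (1 + ‖Y.2‖) ^ N4 ≤ (1 + ‖Y.2‖) ^ (N3 + N4) :=
    pow_le_pow_right₀ (by linarith) (by omega)
  set q := (1 + ‖Y.2‖) ^ (N3 + N4) with hq
  have hq0 : 0 ≤ q := by linarith
  obtain ⟨S, hS⟩ : ∃ S : En n × En n → ℂ, S = fun X => σ X.1 X.2 := ⟨_, rfl⟩
  have hSc : ContDiff ℝ ∞ S := hS ▸ hσ.1
  have hSY : ContDiff ℝ ∞ fun X => S (-Y + ContinuousLinearMap.id ℝ (En n × En n) X) :=
    hSc.comp (contDiff_const.add (ContinuousLinearMap.contDiff _))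
  have hpos : ∀ (ξ : En n) (b : ℝ), 0 < Λ ξ ^ b := fun ξ b => Real.rpow_pos_of_pos (hw.pos ξ) b
  have hshift : ∀ ξ, D1 * Λ ξ ^ a + D1 * Λ (ξ - Y.2) ^ a ≤
      D * (Λ ξ ^ a + q * Λ ξ ^ (a - ρ)) := by
    intro ξ
    have h1 := (hslow ξ (-Y.2)).1
    rw [← sub_eq_add_neg, norm_neg] at h1
    have hX := hpos ξ a
    have hZ := hpos ξ (a - ρ)
    have h2 : Λ (ξ - Y.2) ^ a ≤ D4 * Λ ξ ^ a + D4 * q * Λ ξ ^ (a - ρ) := h1.trans (by gcongr)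
    have hqZ : 0 ≤ q * Λ ξ ^ (a - ρ) := by positivity
    calc _ ≤ D1 * Λ ξ ^ a + D1 * (D4 * Λ ξ ^ a + D4 * q * Λ ξ ^ (a - ρ)) := by gcongr
      _ ≤ (D1 * (1 + D4)) * (Λ ξ ^ a + q * Λ ξ ^ (a - ρ)) := by nlinarith
      _ ≤ _ := mul_le_mul_of_nonneg_right (by linarith) (by positivity)
  have key := hcv (S - fun X => S (-Y + ContinuousLinearMap.id ℝ (En n × En n) X))
    (fun ξ => D * (‖Y.1‖ * Λ ξ ^ a + q * Λ ξ ^ (a - ρ)))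
    (fun ξ => D * (Λ ξ ^ a + q * Λ ξ ^ (a - ρ)))
    (fun ξ => D * (1 + e) * √‖Y.1‖ * Λ ξ ^ a +
      D * (1 + e) * ((1 + ‖Y.1‖) * q) * Λ ξ ^ (a - ρ / 2))
    (hSc.sub hSY) (((tX.const_mul hp).add (tZ.const_mul hq0)).const_mul hD0)
    ((tX.add (tZ.const_mul hq0)).const_mul hD0)
    ((tX.const_mul (by positivity)).add (tV.const_mul (by positivity)))
    ((continuous_const.mul (hw.continuous_rpow a)).add
      (continuous_const.mul (hw.continuous_rpow _)))
    ?_ ?_ ?_ ?_ u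
  · rw [hw.lintegral_wnorm_add _ _ _ (by positivity) (by positivity)] at key
    have h1 := ENNReal.toReal_mono (ENNReal.mul_ne_top hC ENNReal.ofReal_ne_top) key
    have n1 := hw.wnorm_nonneg a (ftS u)
    have n2 := hw.wnorm_nonneg (a - ρ / 2) (ftS u)
    rw [ENNReal.toReal_mul, ENNReal.toReal_ofReal (by positivity), toReal_enorm] at h1
    convert h1 using 1
    · congr 2 with X
      simp [hS, sub_eq_neg_add]
    · ring
  · intro ξ
    have hX := hpos ξ a
    have hZ := hpos ξ (a - ρ)
    have hV := hpos ξ (a - ρ / 2)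
    have h1 := weight_product_le hp hq1 he.le hX.le hZ.le hV.le
      (by rw [← Real.rpow_add (hw.pos ξ), ← Real.rpow_natCast, ← Real.rpow_mul (hw.pos ξ).le]
          congr 1; push_cast; ring)
      (by have := hlow ξ
          rwa [show a - ρ / 2 - ρ / 2 = a - ρ by ring] at this)
    have h2 := mul_le_mul_of_nonneg_left h1 (sq_nonneg D)
    calc _ = D ^ 2 * ((‖Y.1‖ * Λ ξ ^ a + q * Λ ξ ^ (a - ρ)) * (Λ ξ ^ a + q * Λ ξ ^ (a - ρ))) := by
          ring
      _ ≤ _ := h2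
      _ = _ := by ring
  · intro X
    have hX := hpos X.2 a
    have hZ := hpos X.2 (a - ρ)
    have h1 := hleft X.1 Y.1 X.2
    have h2 := hright (X.1 - Y.1) X.2 Y.2
    have h3 : (S - fun X => S (-Y + ContinuousLinearMap.id ℝ (En n × En n) X)) X =
        (σ X.1 X.2 - σ (X.1 - Y.1) X.2) + (σ (X.1 - Y.1) X.2 - σ (X.1 - Y.1) (X.2 - Y.2)) := by
      simp [hS, ← sub_eq_neg_add]
    rw [h3]
    refine (norm_add_le _ _).trans ((add_le_add h1 h2).trans ?_)
    rw [mul_add, ← mul_assoc, ← mul_assoc]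
    gcongr <;> linarith
  · intro X
    have h3 : (S - fun X => S (-Y + ContinuousLinearMap.id ℝ (En n × En n) X)) X =
        σ X.1 X.2 - σ (X.1 - Y.1) (X.2 - Y.2) := by
      simp [hS, sub_eq_neg_add]
    rw [h3]
    exact (norm_sub_le _ _).trans ((add_le_add (hσ0 _ _) (hσ0 _ _)).trans (hshift X.2))
  · intro j i hi X
    rw [dirD_iterate_sub hSc hSY, Pi.sub_apply, dirD_iterate_comp_affine _ _ _ _ _ hSc]
    refine (norm_sub_le _ _).trans (le_trans (add_le_add ?_ ?_) (hshift X.2))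
    · rw [hS]
      exact hpure j i hi X
    · have := hpure j i hi (X - Y)
      rw [hS]
      simpa [sub_eq_neg_add] using this

end

noncomputable section

open scoped FourierTransform ContDiff ComplexConjugate SchwartzMap

variable {n : ℕ} {Λ : En n → ℝ} {μ₀ μ₁ μ ρ a : ℝ} {σ : En n → En n → ℂ}

lemma IsWeight.exists_rpow_le_pow (hw : IsWeight n Λ μ₀ μ₁ μ) (a : ℝ) :
    ∃ (A : ℝ) (M : ℕ), 0 ≤ A ∧ ∀ ξ, Λ ξ ^ a ≤ A * (1 + ‖ξ‖) ^ M := by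
  obtain ⟨A, M, hA, hT⟩ := hw.exists_temperate a
  have h0 := Real.rpow_pos_of_pos (hw.pos 0) a
  refine ⟨A * Λ 0 ^ a, M, by positivity, fun ξ => ?_⟩
  have := hT.2 0 ξ
  rw [zero_add] at this
  linarith

lemma SClass.exists_norm_le_pow (hw : IsWeight n Λ μ₀ μ₁ μ) (hρ : 0 < ρ) (hσ : SClass Λ ρ a σ) :
    ∃ (A : ℝ) (M : ℕ), ∀ X : En n × En n, ‖σ X.1 X.2‖ ≤ A * (1 + ‖X.2‖) ^ M := by
  obtain ⟨C, hC, h, -⟩ := hσ.exists_pureBound hw hρ 0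
  obtain ⟨A, M, hA, h'⟩ := hw.exists_rpow_le_pow a
  refine ⟨C * A, M, fun X => (h _ _).trans ?_⟩
  rw [mul_assoc]
  gcongr
  exact h' _

lemma integral_pdo_mul_conj {A : ℝ} {M : ℕ} (hc : Continuous fun X : En n × En n => σ X.1 X.2)
    (hA : ∀ X : En n × En n, ‖σ X.1 X.2‖ ≤ A * (1 + ‖X.2‖) ^ M) (φ : 𝓢(En n, ℂ)) :
    ∫ x, pdo σ φ x * conj (φ x) =
      cn n * ∫ X : En n × En n, σ X.1 X.2 * Rk φ (ftS φ) X := by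
  have h := integrable_mul_Rk φ (ftS φ) hc hA
  rw [Measure.volume_eq_prod] at h ⊢
  rw [integral_prod _ h, ← integral_const_mul]
  refine integral_congr_ae (Eventually.of_forall fun x => ?_)
  simp only [pdo, Rk, ← ftS_apply]
  rw [mul_assoc, ← integral_mul_const]
  congr 1
  refine integral_congr_ae (Eventually.of_forall fun ξ => ?_)
  simp only [cis]
  ring

/-- The phase-space dilation by `κ⁻¹` in position and `κ` in frequency. -/
def dil (κ : ℝ) (Y : En n × En n) : En n × En n := (κ⁻¹ • Y.1, κ • Y.2)

lemma continuous_dil (κ : ℝ) : Continuous (dil (n := n) κ) := by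
  unfold dil; fun_prop

lemma integrable_fiberwise_translate {G : Type*} [NormedAddCommGroup G] [NormedSpace ℝ G]
    [MeasurableSpace G] [BorelSpace G] [FiniteDimensional ℝ G] {ν : Measure G} [ν.IsAddHaarMeasure]
    {F : G × G → ℂ} (hF : Integrable F (ν.prod ν)) {L : G → G} (hL : Continuous L)
    (hc : Continuous F) : Integrable (fun P : G × G => F (P.1, P.2 + L P.1)) (ν.prod ν) := by
  have := FiniteDimensional.proper ℝ G
  rw [integrable_prod_iff (Continuous.aestronglyMeasurable (by fun_prop))]
  have h := (integrable_prod_iff hc.aestronglyMeasurable).1 hF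
  refine ⟨h.1.mono fun y hy => hy.comp_add_right (L y), ?_⟩
  refine h.2.congr (Eventually.of_forall fun y => ?_)
  exact (integral_add_right_eq_self (fun x => ‖F (y, x)‖) (L y)).symm

lemma integrable_winR_mul_shift (g u v : 𝓢(En n, ℂ)) {S : En n × En n → ℂ} (hS : Continuous S)
    {A : ℝ} {M : ℕ} (hA : ∀ X, ‖S X‖ ≤ A * (1 + ‖X.2‖) ^ M) {κ : ℝ} (hκ : 1 ≤ κ) :
    Integrable (fun P : (En n × En n) × (En n × En n) =>
      winR g P.1 * (S (P.2 - dil κ P.1) * Rk u v P.2)) (volume.prod volume) := by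
  have h1 : Integrable (fun Y : En n × En n => (1 + ‖Y.2‖) ^ M * ‖winR g Y‖) := by
    have h := (g.integrable (μ := volume)).norm.mul_prod ((oscS g).integrable_one_add_norm_pow_mul M)
    rw [Measure.volume_eq_prod]
    refine h.congr (Eventually.of_forall fun X => ?_)
    simp only [winR, norm_mul, norm_cis]
    ring
  have hA0 : 0 ≤ A := by
    have := (norm_nonneg _).trans (hA 0)
    simpa using this
  refine ((h1.mul_prod (integrable_pow_mul_norm_Rk u v M)).const_mul (A * κ ^ M)).mono' ?_
    (Eventually.of_forall fun P => ?_)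
  · have := continuous_winR g
    have := continuous_Rk u v
    have := continuous_dil (n := n) κ
    exact Continuous.aestronglyMeasurable (by fun_prop)
  · have h2 : 1 + ‖(P.2 - dil κ P.1).2‖ ≤ κ * ((1 + ‖P.1.2‖) * (1 + ‖P.2.2‖)) := by
      have : ‖(P.2 - dil κ P.1).2‖ ≤ ‖P.2.2‖ + κ * ‖P.1.2‖ := by
        refine (norm_sub_le _ _).trans_eq ?_
        simp [dil, norm_smul, abs_of_pos (by linarith : 0 < κ)]
      nlinarith [norm_nonneg P.2.2, norm_nonneg P.1.2, mul_nonneg (norm_nonneg P.2.2)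
        (norm_nonneg P.1.2), mul_nonneg (sub_nonneg.2 hκ) (norm_nonneg P.2.2)]
    rw [norm_mul, norm_mul]
    calc _ ≤ ‖winR g P.1‖ * (A * (κ * ((1 + ‖P.1.2‖) * (1 + ‖P.2.2‖))) ^ M * ‖Rk u v P.2‖) := by
          gcongr
          exact (hA _).trans (by gcongr)
      _ = _ := by rw [mul_pow, mul_pow]; ring

lemma integrable_and_integral_averaged (g u : 𝓢(En n, ℂ)) (hg : ∀ y, conj (g y) = g y)
    {S : En n × En n → ℂ} (hS : Continuous S) {A : ℝ} {M : ℕ}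
    (hA : ∀ X, ‖S X‖ ≤ A * (1 + ‖X.2‖) ^ M) {κ : ℝ} (hκ : 1 ≤ κ) :
    Integrable (fun X : En n × En n => S X * (‖Vk g (ftS u) κ X.1 X.2‖ ^ 2 : ℝ)) ∧
    ∫ Y : En n × En n, winR g Y * ∫ X : En n × En n, S (X - dil κ Y) * Rk u (ftS u) X =
      (cn n * κ ^ n : ℝ) * ∫ X : En n × En n, S X * (‖Vk g (ftS u) κ X.1 X.2‖ ^ 2 : ℝ) := by
  have hκ0 : 0 < κ := by linarith
  have h1 := integrable_winR_mul_shift g u (ftS u) hS hA hκ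
  have hwc := continuous_winR g
  have hRc := continuous_Rk u (ftS u)
  have hdc := continuous_dil (n := n) κ
  have h2 := integrable_fiberwise_translate h1 hdc (by fun_prop)
  simp only [add_sub_cancel_right] at h2
  have hin : ∀ X : En n × En n, ∫ Y : En n × En n, winR g Y * (S X * Rk u (ftS u) (X + dil κ Y)) =
      (cn n * κ ^ n : ℝ) * (S X * (‖Vk g (ftS u) κ X.1 X.2‖ ^ 2 : ℝ)) := by
    intro X
    have h := integral_winR_mul_Rk g u (ftS u) hg hκ0 X.1 X.2 0 0
    simp only [inner_zero_left, add_zero, cis_zero, one_mul, smul_zero] at h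
    have h3 : ∀ Y : En n × En n, winR g Y * (S X * Rk u (ftS u) (X + dil κ Y)) =
        S X * (winR g Y * Rk u (ftS u) (X.1 + κ⁻¹ • Y.1, X.2 + κ • Y.2)) := by
      intro Y
      have : X + dil κ Y = (X.1 + κ⁻¹ • Y.1, X.2 + κ • Y.2) := rfl
      rw [this]; ring
    simp only [h3]
    rw [integral_const_mul, h, Uk_eq g u hκ0]
    have h4 : cis ⟪X.1, X.2⟫ * conj (cis ⟪X.1, X.2⟫) = 1 := by
      rw [Complex.mul_conj']; simp
    have h5 := Complex.mul_conj' (Vk g (ftS u) κ X.1 X.2)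
    simp only [map_mul, Complex.conj_ofReal]
    push_cast at h5 ⊢
    rw [← h5]
    linear_combination (S X * (cn n * κ ^ n) * conj (Vk g (ftS u) κ X.1 X.2) *
      Vk g (ftS u) κ X.1 X.2) * h4
  have hc : ((cn n * κ ^ n : ℝ) : ℂ) ≠ 0 := by
    have := cn_pos (n := n)
    exact_mod_cast (by positivity : cn n * κ ^ n ≠ 0)
  constructor
  · have h3 := h2.integral_prod_right
    simp only [hin] at h3
    exact (integrable_const_mul_iff (isUnit_iff_ne_zero.2 hc) _).1 h3
  · rw [← integral_const_mul]
    simp only [← hin]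
    rw [← integral_integral_swap h2]
    refine integral_congr_ae (Eventually.of_forall fun Y => ?_)
    simp only
    rw [← integral_const_mul, ← integral_add_right_eq_self _ (dil κ Y)]
    simp only [add_sub_cancel_right]

end

noncomputable section

open scoped FourierTransform ContDiff ComplexConjugate SchwartzMap

variable {n : ℕ} {Λ : En n → ℝ} {μ₀ μ₁ μ ρ a : ℝ} {σ : En n → En n → ℂ}

/-- The energy of the wave packet transform of `v`, weighted by `Λ ^ b`. -/
def energy (Λ : En n → ℝ) (b : ℝ) (g v : 𝓢(En n, ℂ)) (κ : ℝ) : ℝ :=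
  ∫ X : En n × En n, Λ X.2 ^ b * ‖Vk g v κ X.1 X.2‖ ^ 2

lemma IsWeight.integrable_energy (hw : IsWeight n Λ μ₀ μ₁ μ) (b : ℝ) (g u : 𝓢(En n, ℂ))
    (hg : ∀ y, conj (g y) = g y) {κ : ℝ} (hκ : 1 ≤ κ) :
    Integrable fun X : En n × En n => Λ X.2 ^ b * ‖Vk g (ftS u) κ X.1 X.2‖ ^ 2 := by
  obtain ⟨A, M, hA, h⟩ := hw.exists_rpow_le_pow b
  have hc := hw.continuous_rpow b
  have h1 := (integrable_and_integral_averaged g u hg (S := fun X => ((Λ X.2 ^ b : ℝ) : ℂ))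
    (Complex.continuous_ofReal.comp (hc.comp continuous_snd)) (A := A) (M := M) (fun X => by
      rw [Complex.norm_real, Real.norm_of_nonneg (Real.rpow_pos_of_pos (hw.pos _) b).le]
      exact h _) hκ).1
  simpa only [← Complex.ofReal_mul, RCLike.re_eq_complex_re, Complex.ofReal_re] using h1.re

lemma IsWeight.energy_nonneg (hw : IsWeight n Λ μ₀ μ₁ μ) (b : ℝ) (g v : 𝓢(En n, ℂ)) (κ : ℝ) :
    0 ≤ energy Λ b g v κ :=
  integral_nonneg fun X => mul_nonneg (Real.rpow_pos_of_pos (hw.pos _) b).le (by positivity)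

lemma IsWeight.ofReal_energy (hw : IsWeight n Λ μ₀ μ₁ μ) (b : ℝ) (g u : 𝓢(En n, ℂ))
    (hg : ∀ y, conj (g y) = g y) {κ : ℝ} (hκ : 1 ≤ κ) :
    ENNReal.ofReal (energy Λ b g (ftS u) κ) =
      ∫⁻ ξ, ENNReal.ofReal (Λ ξ ^ b) * ∫⁻ x, ‖Vk g (ftS u) κ x ξ‖ₑ ^ 2 := by
  have hV := continuous_Vk g (ftS u) κ
  have hc := hw.continuous_rpow b
  have hm : Measurable fun X : En n × En n =>
      ENNReal.ofReal (Λ X.2 ^ b * ‖Vk g (ftS u) κ X.1 X.2‖ ^ 2) :=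
    ((hc.comp continuous_snd).mul (hV.norm.pow 2)).measurable.ennreal_ofReal
  rw [energy, ofReal_integral_eq_lintegral_ofReal (hw.integrable_energy b g u hg hκ)
    (Eventually.of_forall fun X => mul_nonneg (Real.rpow_pos_of_pos (hw.pos _) b).le
      (by positivity)), Measure.volume_eq_prod, lintegral_prod_symm _
        hm.aemeasurable]
  refine lintegral_congr fun ξ => ?_
  rw [← lintegral_const_mul' _ _ ENNReal.ofReal_ne_top]
  refine lintegral_congr fun x => ?_
  rw [ENNReal.ofReal_mul (Real.rpow_pos_of_pos (hw.pos ξ) b).le,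
    ENNReal.ofReal_pow (norm_nonneg _), ofReal_norm]

lemma IsWeight.energy_le (hw : IsWeight n Λ μ₀ μ₁ μ) (b : ℝ) (g : 𝓢(En n, ℂ))
    (hg : ∀ y, conj (g y) = g y) {κ : ℝ} (hκ : 1 ≤ κ) :
    ∃ K, 0 ≤ K ∧ ∀ u, energy Λ b g (ftS u) κ ≤ K * wnorm Λ b (ftS u) := by
  obtain ⟨A, M, hA, hT⟩ := hw.exists_temperate b
  obtain ⟨C, hC, h⟩ := lintegral_weight_Vk_le g (by linarith : 0 ≤ A) M (by linarith : 0 < κ)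
  refine ⟨C.toReal, ENNReal.toReal_nonneg, fun u => ?_⟩
  have h1 := h (ftS u) _ (hw.continuous_rpow b) hT
  rw [← hw.ofReal_energy b g u hg hκ, hw.lintegral_wnorm] at h1
  have h2 := ENNReal.toReal_mono (ENNReal.mul_ne_top hC ENNReal.ofReal_ne_top) h1
  rwa [ENNReal.toReal_mul, ENNReal.toReal_ofReal (hw.wnorm_nonneg _ _),
    ENNReal.toReal_ofReal (hw.energy_nonneg _ _ _ _)] at h2

lemma IsWeight.le_energy (hw : IsWeight n Λ μ₀ μ₁ μ) (hρ : 0 < ρ) (a : ℝ) (g : 𝓢(En n, ℂ))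
    (hg : IsWindow g) :
    ∃ c > 0, ∀ κ, 1 ≤ κ → ∃ K, 0 ≤ K ∧ ∀ u,
      c * wnorm Λ a (ftS u) - K * wnorm Λ (a - ρ / 2) (ftS u) ≤
        κ ^ n * energy Λ a g (ftS u) κ := by
  obtain ⟨C, M, hC, hslow⟩ := hw.exists_slow a (half_pos hρ)
  obtain ⟨g0, hg0, hG0⟩ : ∃ g0 > 0, ∫⁻ t, ‖oscS g t‖ₑ ^ 2 = ENNReal.ofReal g0 := by
    refine ⟨∫ t, ‖oscS g t‖ ^ 2, ?_, ?_⟩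
    · simp only [oscS_apply]
      rw [integral_norm_sq_osc]
      have := hg.2
      positivity
    · exact lintegral_enorm_sq _
  obtain ⟨g1, hg1, hG1⟩ : ∃ g1, 0 ≤ g1 ∧
      ∫⁻ t, ‖oscS g t‖ₑ ^ 2 * ENNReal.ofReal ((1 + ‖t‖) ^ M) = ENNReal.ofReal g1 :=
    ⟨_, ENNReal.toReal_nonneg,
      (ENNReal.ofReal_toReal (lintegral_enorm_sq_mul_pow_ne_top (oscS g) M)).symm⟩
  refine ⟨(2 * π) ^ n * g0 / C, by positivity, fun κ hκ => ⟨(2 * π) ^ n * (κ ^ M * g1),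
    by positivity, fun u => ?_⟩⟩
  have hκ0 : 0 < κ := by linarith
  have hv := (ftS u).continuous
  have hgc := (oscS g).continuous
  have hΛ := hw.smooth.continuous
  have hE := hw.ofReal_energy a g u hg.1 hκ
  rw [lintegral_weight_Vk g (ftS u) hκ0 _ (by fun_prop)] at hE
  set T := ∫⁻ ζ, ‖ftS u ζ‖ₑ ^ 2 * ∫⁻ t, ‖oscS g t‖ₑ ^ 2 * ENNReal.ofReal (Λ (ζ - κ • t) ^ a)
    with hT
  have hTE : T = ENNReal.ofReal ((κ / (2 * π)) ^ n * energy Λ a g (ftS u) κ) := by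
    rw [ENNReal.ofReal_mul (by positivity), hE, ← mul_assoc,
      ← ENNReal.ofReal_mul (by positivity), ← mul_pow,
      show κ / (2 * π) * (2 * π / κ) = 1 by field_simp]
    simp
  have key : ENNReal.ofReal (wnorm Λ a (ftS u)) * ENNReal.ofReal g0 ≤
      ENNReal.ofReal C * T + ENNReal.ofReal (C * κ ^ M) * ENNReal.ofReal g1 *
        ENNReal.ofReal (wnorm Λ (a - ρ / 2) (ftS u)) := by
    rw [← hw.lintegral_wnorm, ← hw.lintegral_wnorm, hT,
      ← lintegral_const_mul' _ _ ENNReal.ofReal_ne_top,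
      ← lintegral_const_mul' _ _ (ENNReal.mul_ne_top ENNReal.ofReal_ne_top ENNReal.ofReal_ne_top),
      ← lintegral_mul_const' _ _ ENNReal.ofReal_ne_top, ← lintegral_add_right _ (by fun_prop)]
    refine lintegral_mono fun ζ => ?_
    have h1 : ENNReal.ofReal (Λ ζ ^ a) * ENNReal.ofReal g0 ≤
        ENNReal.ofReal C * (∫⁻ t, ‖oscS g t‖ₑ ^ 2 * ENNReal.ofReal (Λ (ζ - κ • t) ^ a)) +
          ENNReal.ofReal (C * κ ^ M) * ENNReal.ofReal (Λ ζ ^ (a - ρ / 2)) *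
            ENNReal.ofReal g1 := by
      rw [← hG0, ← hG1, ← lintegral_const_mul' _ _ ENNReal.ofReal_ne_top,
        ← lintegral_const_mul' _ _ ENNReal.ofReal_ne_top,
        ← lintegral_const_mul' _ _ (ENNReal.mul_ne_top ENNReal.ofReal_ne_top ENNReal.ofReal_ne_top),
        ← lintegral_add_right _ (by fun_prop)]
      refine lintegral_mono fun t => ?_
      have p1 := Real.rpow_pos_of_pos (hw.pos (ζ - κ • t)) a
      have p2 := Real.rpow_pos_of_pos (hw.pos ζ) (a - ρ / 2)
      have h2 : Λ ζ ^ a ≤ C * Λ (ζ - κ • t) ^ a +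
          C * κ ^ M * Λ ζ ^ (a - ρ / 2) * (1 + ‖t‖) ^ M := by
        have h3 := (hslow ζ (-(κ • t))).2
        rw [← sub_eq_add_neg, norm_neg, norm_smul, Real.norm_of_nonneg hκ0.le] at h3
        have h4 : (1 + κ * ‖t‖) ^ M ≤ κ ^ M * (1 + ‖t‖) ^ M := by
          rw [← mul_pow]
          gcongr
          linarith
        refine h3.trans ?_
        have h5 : C * (1 + κ * ‖t‖) ^ M * Λ ζ ^ (a - ρ / 2) ≤
            C * (κ ^ M * (1 + ‖t‖) ^ M) * Λ ζ ^ (a - ρ / 2) := by gcongr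
        linarith
      have h3 := ENNReal.ofReal_le_ofReal h2
      rw [ENNReal.ofReal_add (by positivity) (by positivity), ENNReal.ofReal_mul (by positivity),
        ENNReal.ofReal_mul (p := C * κ ^ M * Λ ζ ^ (a - ρ / 2)) (by positivity),
        ENNReal.ofReal_mul (p := C * κ ^ M) (by positivity)] at h3
      calc _ ≤ _ := mul_le_mul_left h3 _
        _ = _ := by ring
    calc _ = (ENNReal.ofReal (Λ ζ ^ a) * ENNReal.ofReal g0) * ‖ftS u ζ‖ₑ ^ 2 := by ring
      _ ≤ _ := mul_le_mul_left h1 _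
      _ = _ := by ring
  have n1 := hw.wnorm_nonneg a (ftS u)
  have n2 := hw.wnorm_nonneg (a - ρ / 2) (ftS u)
  have n3 := hw.energy_nonneg a g (ftS u) κ
  rw [hTE, ← ENNReal.ofReal_mul n1, ← ENNReal.ofReal_mul (by positivity),
    ← ENNReal.ofReal_mul (by positivity), ← ENNReal.ofReal_mul (by positivity),
    ← ENNReal.ofReal_add (by positivity) (by positivity),
    ENNReal.ofReal_le_ofReal_iff (by positivity)] at key
  have h1 : (2 * π) ^ n * g0 / C * wnorm Λ a (ftS u) =
      (2 * π) ^ n / C * (wnorm Λ a (ftS u) * g0) := by ring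
  have h2 := mul_le_mul_of_nonneg_left key (by positivity : 0 ≤ (2 * π) ^ n / C)
  rw [h1, sub_le_iff_le_add]
  refine h2.trans_eq ?_
  rw [div_pow]
  field_simp

end

noncomputable section

open scoped FourierTransform ContDiff ComplexConjugate SchwartzMap

variable {n : ℕ} {Λ : En n → ℝ} {μ₀ μ₁ μ ρ a : ℝ} {σ : En n → En n → ℂ}

lemma SClass.exists_re_lower_bound (hw : IsWeight n Λ μ₀ μ₁ μ) (hρ : 0 < ρ)
    (hσ : SClass Λ ρ a σ) {C R : ℝ} (hC : 0 < C)
    (hell : ∀ x ξ : En n, R ≤ ‖ξ‖ → C * Λ ξ ^ a ≤ (σ x ξ).re) :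
    ∃ K, 0 ≤ K ∧ ∀ x ξ, C * Λ ξ ^ a - K * Λ ξ ^ (a - ρ / 2) ≤ (σ x ξ).re := by
  obtain ⟨D, hD, hσ0, -⟩ := hσ.exists_pureBound hw hρ 0
  obtain ⟨A, M, hA, hΛ⟩ := hw.exists_rpow_le_pow (ρ / 2)
  refine ⟨(C + D) * (A * (1 + |R|) ^ M), by positivity, fun x ξ => ?_⟩
  have h1 := Real.rpow_pos_of_pos (hw.pos ξ) (a - ρ / 2)
  rcases le_or_gt R ‖ξ‖ with h | h
  · have : 0 ≤ (C + D) * (A * (1 + |R|) ^ M) * Λ ξ ^ (a - ρ / 2) := by positivity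
    linarith [hell x ξ h]
  · have h2 : Λ ξ ^ a ≤ A * (1 + |R|) ^ M * Λ ξ ^ (a - ρ / 2) := by
      have h3 : Λ ξ ^ a = Λ ξ ^ (ρ / 2) * Λ ξ ^ (a - ρ / 2) := by
        rw [← Real.rpow_add (hw.pos ξ)]
        congr 1
        ring
      rw [h3]
      gcongr
      refine (hΛ ξ).trans ?_
      gcongr
      exact h.le.trans (le_abs_self R)
    have h3 := (abs_le.1 ((Complex.abs_re_le_norm _).trans (hσ0 x ξ))).1
    have h4 := mul_le_mul_of_nonneg_left h2 (by positivity : 0 ≤ C + D)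
    linarith

lemma integrable_shift_mul_Rk (u v : 𝓢(En n, ℂ)) {S : En n × En n → ℂ} (hS : Continuous S)
    {A : ℝ} {M : ℕ} (hA : ∀ X, ‖S X‖ ≤ A * (1 + ‖X.2‖) ^ M) (Y : En n × En n) :
    Integrable fun X => S (X - Y) * Rk u v X := by
  have hA0 : 0 ≤ A := by
    have := (norm_nonneg _).trans (hA 0)
    simpa using this
  refine integrable_mul_Rk u v (b := fun X => S (X - Y)) (by fun_prop)
    (A := A * (1 + ‖Y.2‖) ^ M) (M := M) fun X => ?_
  refine (hA _).trans ?_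
  rw [mul_assoc, ← mul_pow]
  gcongr
  have := norm_sub_le X.2 Y.2
  rw [Prod.snd_sub]
  nlinarith [norm_nonneg X.2, norm_nonneg Y.2]

theorem SClass.average_form_bound (hw : IsWeight n Λ μ₀ μ₁ μ) (hρ : 0 < ρ)
    (hσ : SClass Λ ρ a σ) (g : 𝓢(En n, ℂ)) :
    ∃ (K : ℝ) (N : ℕ), 0 ≤ K ∧ ∀ κ, 1 ≤ κ → ∀ u,
      ‖(∫ Y, winR g Y) * (∫ X : En n × En n, σ X.1 X.2 * Rk u (ftS u) X) -
        ∫ Y, winR g Y * ∫ X : En n × En n,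
          σ (X - dil κ Y).1 (X - dil κ Y).2 * Rk u (ftS u) X‖ ≤
        K * (√κ⁻¹ * wnorm Λ a (ftS u) + κ ^ N * wnorm Λ (a - ρ / 2) (ftS u)) := by
  obtain ⟨C, N, hC, hb⟩ := hσ.shift_form_bound hw hρ
  obtain ⟨A, M, hA⟩ := hσ.exists_norm_le_pow hw hρ
  have hS : Continuous fun X : En n × En n => σ X.1 X.2 := hσ.1.continuous
  have hB : Integrable fun Y : En n × En n => (1 + ‖Y.1‖) * (1 + ‖Y.2‖) ^ N * ‖winR g Y‖ := by
    have h := (g.integrable_one_add_norm_pow_mul 1).mul_prod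
      ((oscS g).integrable_one_add_norm_pow_mul N)
    rw [Measure.volume_eq_prod]
    refine h.congr (Eventually.of_forall fun X => ?_)
    simp only [winR, norm_mul, norm_cis]
    ring
  refine ⟨C * ∫ Y : En n × En n, (1 + ‖Y.1‖) * (1 + ‖Y.2‖) ^ N * ‖winR g Y‖, N,
    mul_nonneg hC (integral_nonneg fun Y => by positivity), fun κ hκ u => ?_⟩
  have hκ0 : 0 < κ := by linarith
  have n1 := hw.wnorm_nonneg a (ftS u)
  have n2 := hw.wnorm_nonneg (a - ρ / 2) (ftS u)
  have hint := (integrable_winR_mul_shift g u (ftS u) hS hA hκ).integral_prod_left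
  simp only [integral_const_mul] at hint
  rw [← integral_mul_const, ← integral_sub ((integrable_winR g).mul_const _) hint]
  rw [mul_right_comm, ← integral_const_mul]
  refine norm_integral_le_of_norm_le (hB.const_mul _) (Eventually.of_forall fun Y => ?_)
  rw [← mul_sub, norm_mul, ← integral_sub (integrable_mul_Rk u (ftS u) hS hA)
    (integrable_shift_mul_Rk u (ftS u) hS hA (dil κ Y))]
  simp only [← sub_mul]
  have h1 := hb (dil κ Y) u
  have h2 : ‖(dil κ Y).1‖ = κ⁻¹ * ‖Y.1‖ := by
    simp [dil, norm_smul, abs_of_pos hκ0]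
  have h3 : ‖(dil κ Y).2‖ = κ * ‖Y.2‖ := by
    simp [dil, norm_smul, abs_of_pos hκ0]
  rw [h2, h3] at h1
  have p1 := norm_nonneg Y.1
  have p2 := norm_nonneg Y.2
  have hN : (1 : ℝ) ≤ (1 + ‖Y.2‖) ^ N := one_le_pow₀ (by linarith)
  have h4 : √(κ⁻¹ * ‖Y.1‖) ≤ √κ⁻¹ * ((1 + ‖Y.1‖) * (1 + ‖Y.2‖) ^ N) := by
    rw [Real.sqrt_mul (by positivity)]
    gcongr
    have : √‖Y.1‖ ≤ 1 + ‖Y.1‖ := Real.sqrt_le_iff.2 ⟨by linarith, by nlinarith⟩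
    nlinarith
  have h5 : (1 + κ⁻¹ * ‖Y.1‖) * (1 + κ * ‖Y.2‖) ^ N ≤
      κ ^ N * ((1 + ‖Y.1‖) * (1 + ‖Y.2‖) ^ N) := by
    have h6 : 1 + κ⁻¹ * ‖Y.1‖ ≤ 1 + ‖Y.1‖ := by
      have := inv_le_one_of_one_le₀ hκ
      nlinarith
    have h7 : (1 + κ * ‖Y.2‖) ^ N ≤ κ ^ N * (1 + ‖Y.2‖) ^ N := by
      rw [← mul_pow]
      gcongr
      linarith
    calc _ ≤ (1 + ‖Y.1‖) * (κ ^ N * (1 + ‖Y.2‖) ^ N) := by gcongr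
      _ = _ := by ring
  calc _ ≤ ‖winR g Y‖ * (C * (√κ⁻¹ * ((1 + ‖Y.1‖) * (1 + ‖Y.2‖) ^ N) * wnorm Λ a (ftS u) +
        κ ^ N * ((1 + ‖Y.1‖) * (1 + ‖Y.2‖) ^ N) * wnorm Λ (a - ρ / 2) (ftS u))) := by
        gcongr
        exact h1.trans (by gcongr)
    _ = _ := by ring

/-- Gårding's inequality with the remainder measured in the weight `Λ ^ (a - ρ / 2)`. -/
theorem SClass.garding_half (hw : IsWeight n Λ μ₀ μ₁ μ) (hρ : 0 < ρ)
    (hσ : SClass Λ ρ a σ) {C R : ℝ} (hC : 0 < C)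
    (hell : ∀ x ξ : En n, R ≤ ‖ξ‖ → C * Λ ξ ^ a ≤ (σ x ξ).re) :
    ∃ c > 0, ∃ K, 0 ≤ K ∧ ∀ u : 𝓢(En n, ℂ),
      c * wnorm Λ a (ftS u) - K * wnorm Λ (a - ρ / 2) (ftS u) ≤
        (∫ X : En n × En n, σ X.1 X.2 * Rk u (ftS u) X).re := by
  obtain ⟨g, hg⟩ := exists_isWindow n
  obtain ⟨A, M, hA⟩ := hσ.exists_norm_le_pow hw hρ
  have hS : Continuous fun X : En n × En n => σ X.1 X.2 := hσ.1.continuous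
  obtain ⟨K1, hK1, hre⟩ := hσ.exists_re_lower_bound hw hρ hC hell
  obtain ⟨c, hc, hlow⟩ := hw.le_energy hρ a g hg
  obtain ⟨K2, N, hK2, herr⟩ := hσ.average_form_bound hw hρ g
  have hcn := cn_pos (n := n)
  obtain ⟨r, hr, hr'⟩ : ∃ r : ℝ, 0 < r ∧ ∫ Y, winR g Y = r :=
    ⟨_, by have := hg.2; positivity, integral_winR g hg.1⟩
  obtain ⟨κ, hκ, hκe⟩ : ∃ κ : ℝ, 1 ≤ κ ∧ K2 * √κ⁻¹ ≤ cn n * C * c / 2 := by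
    have h1 : Tendsto (fun κ : ℝ => K2 * √κ⁻¹) atTop (nhds (K2 * √0)) :=
      (tendsto_inv_atTop_zero.sqrt).const_mul K2
    rw [Real.sqrt_zero, mul_zero] at h1
    have h2 : 0 < cn n * C * c / 2 := by positivity
    obtain ⟨κ, h3, h4⟩ := ((h1.eventually_le_const h2).and (eventually_ge_atTop 1)).exists
    exact ⟨κ, h4, h3⟩
  obtain ⟨K3, hK3, hlow'⟩ := hlow κ hκ
  obtain ⟨K4, hK4, hup⟩ := hw.energy_le (a - ρ / 2) g hg.1 hκ
  have hκ0 : 0 < κ := by linarith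
  refine ⟨cn n * C * c / 2 / r, by positivity,
    (cn n * C * K3 + cn n * κ ^ n * K1 * K4 + K2 * κ ^ N) / r, by positivity, fun u => ?_⟩
  have n1 := hw.wnorm_nonneg a (ftS u)
  have n2 := hw.wnorm_nonneg (a - ρ / 2) (ftS u)
  obtain ⟨hJi, hJ⟩ := integrable_and_integral_averaged g u hg.1 hS hA hκ
  have he := herr κ hκ u
  rw [hJ, hr'] at he
  set I := ∫ X : En n × En n, σ X.1 X.2 * Rk u (ftS u) X
  set J := ∫ X : En n × En n, σ X.1 X.2 * ((‖Vk g (ftS u) κ X.1 X.2‖ ^ 2 : ℝ) : ℂ) with hJdef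
  have hJre : C * energy Λ a g (ftS u) κ - K1 * energy Λ (a - ρ / 2) g (ftS u) κ ≤ J.re := by
    have h1 := hw.integrable_energy a g u hg.1 hκ
    have h2 := hw.integrable_energy (a - ρ / 2) g u hg.1 hκ
    have h3 : J.re = ∫ X : En n × En n, (σ X.1 X.2).re * ‖Vk g (ftS u) κ X.1 X.2‖ ^ 2 := by
      have h := integral_re hJi
      simp only [RCLike.re_eq_complex_re, Complex.re_mul_ofReal] at h
      exact h.symm
    have h4 : Integrable fun X : En n × En n =>
        (σ X.1 X.2).re * ‖Vk g (ftS u) κ X.1 X.2‖ ^ 2 := by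
      simpa only [RCLike.re_eq_complex_re, Complex.re_mul_ofReal] using hJi.re
    rw [h3, energy, energy, ← integral_const_mul, ← integral_const_mul,
      ← integral_sub (h1.const_mul C) (h2.const_mul K1)]
    refine integral_mono ((h1.const_mul C).sub (h2.const_mul K1)) h4 fun X => ?_
    have := mul_le_mul_of_nonneg_right (hre X.1 X.2) (sq_nonneg ‖Vk g (ftS u) κ X.1 X.2‖)
    simp only
    linarith
  have h1 := (abs_le.1 ((Complex.abs_re_le_norm _).trans he)).1
  rw [Complex.sub_re, Complex.re_ofReal_mul, Complex.re_ofReal_mul] at h1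
  have h2 := mul_le_mul_of_nonneg_left hJre (by positivity : 0 ≤ cn n * κ ^ n)
  have h3 := mul_le_mul_of_nonneg_left (hlow' u) (by positivity : 0 ≤ cn n * C)
  have h4 := mul_le_mul_of_nonneg_left (hup u) (by positivity : 0 ≤ cn n * κ ^ n * K1)
  have h5 := mul_le_mul_of_nonneg_right hκe n1
  rw [div_mul_eq_mul_div _ r, div_mul_eq_mul_div _ r, ← sub_div, div_le_iff₀ hr]
  linarith

lemma IsWeight.exists_interpolation (hw : IsWeight n Λ μ₀ μ₁ μ) (hρ : 0 < ρ) (a : ℝ) {s ε : ℝ}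
    (hs : ρ / 2 ≤ s) (hε : 0 < ε) :
    ∃ K > 0, ∀ v : 𝓢(En n, ℂ), wnorm Λ (a - ρ / 2) v ≤
      ε * wnorm Λ a v + K * wnorm Λ (a - 2 * s) v := by
  refine ⟨ε⁻¹ ^ ((2 * s - ρ / 2) / (ρ / 2)), by positivity, fun v => ?_⟩
  rw [wnorm, wnorm, wnorm, ← integral_const_mul, ← integral_const_mul,
    ← integral_add ((hw.integrable_wnorm _ v).const_mul _)
      ((hw.integrable_wnorm _ v).const_mul _)]
  refine integral_mono (hw.integrable_wnorm _ v) (((hw.integrable_wnorm _ v).const_mul _).add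
      ((hw.integrable_wnorm _ v).const_mul _)) fun ξ => ?_
  have hpos := hw.pos ξ
  have p1 := Real.rpow_pos_of_pos hpos a
  have p2 := Real.rpow_pos_of_pos hpos (a - 2 * s)
  have p3 := Real.rpow_pos_of_pos hpos (ρ / 2)
  simp only
  rw [← mul_assoc, ← mul_assoc, ← add_mul]
  gcongr
  rcases le_or_gt (Λ ξ ^ (ρ / 2))⁻¹ ε with h | h
  · have h1 : Λ ξ ^ (a - ρ / 2) ≤ ε * Λ ξ ^ a := by
      rw [Real.rpow_sub hpos, div_eq_inv_mul]
      gcongr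
    have : 0 < ε⁻¹ ^ ((2 * s - ρ / 2) / (ρ / 2)) * Λ ξ ^ (a - 2 * s) := by positivity
    linarith
  · have h1 : Λ ξ ^ (ρ / 2) ≤ ε⁻¹ := by
      have := (lt_inv_comm₀ hε p3).1 h
      exact this.le
    have h2 : Λ ξ ^ (2 * s - ρ / 2) ≤ ε⁻¹ ^ ((2 * s - ρ / 2) / (ρ / 2)) := by
      have h3 : Λ ξ ^ (2 * s - ρ / 2) = (Λ ξ ^ (ρ / 2)) ^ ((2 * s - ρ / 2) / (ρ / 2)) := by
        rw [← Real.rpow_mul hpos.le]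
        congr 1
        field_simp
      rw [h3]
      exact Real.rpow_le_rpow p3.le h1 (div_nonneg (by linarith) (by linarith))
    have h3 : Λ ξ ^ (a - ρ / 2) = Λ ξ ^ (2 * s - ρ / 2) * Λ ξ ^ (a - 2 * s) := by
      rw [← Real.rpow_add hpos]
      congr 1
      ring
    have h4 := mul_le_mul_of_nonneg_right h2 p2.le
    have : 0 < ε * Λ ξ ^ a := by positivity
    linarith

end

/-- Gårding's inequality for M-elliptic operators. -/
theorem garding_M_elliptic (n : ℕ) (hn : 1 ≤ n)
    (Λ : En n → ℝ) (μ₀ μ₁ μ ρ : ℝ)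
    (hw : IsWeight n Λ μ₀ μ₁ μ) (hρ : 0 < ρ) (hρμ : ρ ≤ 1 / μ)
    (m : ℝ) (σ : En n → En n → ℂ) (hσ : MClass Λ ρ (2 * m) σ)
    (C R : ℝ) (hC : 0 < C) (hR : 0 < R)
    (hell : ∀ x ξ : En n, R ≤ ‖ξ‖ → C * Λ ξ ^ (2 * m) ≤ (σ x ξ).re) :
    ∃ C' > 0, ∀ s : ℝ, ρ / 2 ≤ s → ∃ Cs > 0, ∀ φ : SchwartzMap (En n) ℂ,
      C' * (∫ (ξ : En n), Λ ξ ^ (2 * m) * ‖ft (⇑φ) ξ‖ ^ 2) -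
          Cs * ∫ (ξ : En n), Λ ξ ^ (2 * (m - s)) * ‖ft (⇑φ) ξ‖ ^ 2 ≤
        (∫ (x : En n), pdo σ (⇑φ) x * (starRingEnd ℂ) (φ x)).re := by
  have hS := hσ.sClass
  obtain ⟨c, hc, K, hK, h⟩ := hS.garding_half hw hρ hC hell
  obtain ⟨A, M, hA⟩ := hS.exists_norm_le_pow hw hρ
  have hcn := cn_pos (n := n)
  refine ⟨cn n * (c / 2), by positivity, fun s hs => ?_⟩
  obtain ⟨L, hL, hint⟩ := hw.exists_interpolation hρ (2 * m) hs
    (by positivity : 0 < c / (2 * (K + 1)))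
  refine ⟨cn n * ((K + 1) * L), by positivity, fun φ => ?_⟩
  rw [integral_pdo_mul_conj hS.1.continuous hA φ, Complex.re_ofReal_mul, mul_assoc, mul_assoc,
    ← mul_sub]
  refine mul_le_mul_of_nonneg_left (le_trans ?_ (h φ)) hcn.le
  have n2 := hw.wnorm_nonneg (2 * m - ρ / 2) (ftS φ)
  have h1 := mul_le_mul_of_nonneg_left (hint (ftS φ)) (by positivity : 0 ≤ K + 1)
  have h2 : (K + 1) * (c / (2 * (K + 1)) * wnorm Λ (2 * m) (ftS φ)) =
      c / 2 * wnorm Λ (2 * m) (ftS φ) := by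
    field_simp
  simp only [← ftS_apply]
  rw [show 2 * (m - s) = 2 * m - 2 * s by ring]
  change c / 2 * wnorm Λ (2 * m) (ftS φ) - (K + 1) * L * wnorm Λ (2 * m - 2 * s) (ftS φ) ≤ _
  linarith
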